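/- arXiv:2409.06115 — 2 statements merged into one kernel-verified Lean document; each statement's English description precedes it below -/
import Mathlib

section
/- Let S be a finite set and S₁, …, S_ℓ disjoint subsets of S. Let T be a collection of 3-element subsets of S, and let P = (p_s)_{s∈S} ∈ K_T be a tuple of points of ℂ². For each i ∈ [ℓ], let T_i = T ∩ (S_i choose 3) and P_i = (p_s)_{s∈S_i}. Suppose that P_i is r-rigid with respect to T_i for each i, and that the only P' ∈ K_T ⊆ (ℂ²)^S with P'_i = P_i for all i ∈ [ℓ] is P' = P. Then P is (ℓ·r)-rigid with respect to T. -/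
noncomputable section

open MvPolynomial

/-- Flatten a tuple of points of `ℂ²` indexed by `S` into a point of affine
space with coordinates indexed by `S × Fin 2`. -/
def flatten {S : Type*} (Q : S → ℂ × ℂ) : S × Fin 2 → ℂ :=
  fun v => if v.2 = 0 then (Q v.1).1 else (Q v.1).2

/-- A subset of `(ℂ²)^S` is Zariski closed if it is the common zero locus of a
family of polynomials in the `2|S|` coordinates. -/
def ZClosed {S : Type*} (V : Set (S → ℂ × ℂ)) : Prop :=
  ∃ I : Set (MvPolynomial (S × Fin 2) ℂ),
    V = {Q | ∀ f ∈ I, eval (flatten Q) f = 0}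

/-- A subset of `(ℂ²)^S` is irreducible if it is Zariski closed, nonempty, and
is not covered by two Zariski closed sets without being inside one of them. -/
def ZIrred {S : Type*} (V : Set (S → ℂ × ℂ)) : Prop :=
  ZClosed V ∧ V.Nonempty ∧
    ∀ V₁ V₂ : Set (S → ℂ × ℂ), ZClosed V₁ → ZClosed V₂ → V ⊆ V₁ ∪ V₂ →
      V ⊆ V₁ ∨ V ⊆ V₂

/-- `V` is an irreducible component of `K`: an irreducible closed subset of `K`
that is maximal among irreducible closed subsets of `K`. -/
def IsIrredComponent {S : Type*} (K V : Set (S → ℂ × ℂ)) : Prop :=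
  ZIrred V ∧ V ⊆ K ∧ ∀ W : Set (S → ℂ × ℂ), ZIrred W → W ⊆ K → V ⊆ W → V = W

/-- The (Krull) dimension of `V` is at most `r`: every strictly increasing chain
`c 0 ⊂ c 1 ⊂ ⋯ ⊂ c k` of irreducible closed subsets of `V` has `k ≤ r`. -/
def ZDimLE {S : Type*} (V : Set (S → ℂ × ℂ)) (r : ℕ) : Prop :=
  ∀ (k : ℕ) (c : Fin (k + 1) → Set (S → ℂ × ℂ)),
    (∀ i, ZIrred (c i)) → (∀ i, c i ⊆ V) → StrictMono c → k ≤ r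

/-- The variety `K_T ⊆ (ℂ²)^S` of tuples of points satisfying the collinearity
conditions given by the triples in `T`. -/
def KT {S : Type*} (T : Set (Set S)) : Set (S → ℂ × ℂ) :=
  {Q | ∀ t ∈ T, Collinear ℂ (Q '' t)}

/-- `P ∈ K_T` is `r`-rigid with respect to `T` if every irreducible component of
`K_T` containing `P` has dimension at most `r`. -/
def IsRigid {S : Type*} (T : Set (Set S)) (P : S → ℂ × ℂ) (r : ℕ) : Prop :=
  P ∈ KT T ∧
    ∀ V : Set (S → ℂ × ℂ), IsIrredComponent (KT T) V → P ∈ V → ZDimLE V r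

open scoped Pointwise in
/-- Going down for the extension `N → C` along a finite group action with invariants `N`. -/
theorem Ideal.exists_le_liesOver_of_isInvariant {N C : Type*} (G : Type*) [CommRing N] [CommRing C]
    [IsDomain C] [Algebra N C] [Algebra.IsIntegral N C] [FaithfulSMul N C] [Group G] [Finite G]
    [MulSemiringAction G C] [SMulCommClass G N C] [Algebra.IsInvariant N C G]
    {p q : Ideal N} [p.IsPrime] [q.IsPrime] (h : p ≤ q) (Q : Ideal C) [Q.IsPrime] [Q.LiesOver q] :
    ∃ P ≤ Q, P.IsPrime ∧ P.LiesOver p := by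
  obtain ⟨P₀, hP₀, hP₀p⟩ := Ideal.exists_ideal_over_prime_of_isIntegral_of_isDomain (S := C) p
    (by rw [(RingHom.injective_iff_ker_eq_bot _).1 (FaithfulSMul.algebraMap_injective N C)]
        exact bot_le)
  have : P₀.LiesOver p := ⟨hP₀p.symm⟩
  obtain ⟨Q₀, hPQ, hQ₀, hQ₀q⟩ := Ideal.exists_ideal_ge_liesOver_of_le P₀ h
  obtain ⟨g, rfl⟩ := Algebra.IsInvariant.exists_smul_of_under_eq N C G Q₀ Q
    ((Q₀.over_def q).symm.trans (Q.over_def q))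
  exact ⟨g • P₀, Ideal.pointwise_smul_le_pointwise_smul_iff.2 hPQ, inferInstance, inferInstance⟩

/-- Going down holds for finite extensions of integrally closed domains of characteristic zero. -/
theorem Algebra.HasGoingDown.of_isIntegrallyClosed (N A : Type*) [CommRing N] [IsDomain N]
    [IsIntegrallyClosed N] [CharZero N] [CommRing A] [IsDomain A] [Algebra N A] [FaithfulSMul N A]
    [Module.Finite N A] : Algebra.HasGoingDown N A := by
  let K := FractionRing N
  let F := FractionRing A
  let : Algebra K F := FractionRing.liftAlgebra N F
  have : CharZero K := charZero_of_injective_algebraMap (IsFractionRing.injective N K)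
  let L := IntermediateField.normalClosure K F (AlgebraicClosure F)
  have : FiniteDimensional K L := inferInstance
  have : IsGalois K L := ⟨⟩
  let : Algebra A L := ((algebraMap F L).comp (algebraMap A F)).toAlgebra
  have : IsScalarTower A F L := IsScalarTower.of_algebraMap_eq fun _ => rfl
  let : Algebra N L := ((algebraMap K L).comp (algebraMap N K)).toAlgebra
  have : IsScalarTower N K L := IsScalarTower.of_algebraMap_eq fun _ => rfl
  have : IsScalarTower N A L := IsScalarTower.of_algebraMap_eq fun x => by
    rw [IsScalarTower.algebraMap_apply N K L, IsScalarTower.algebraMap_apply K F L,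
      IsScalarTower.algebraMap_apply A F L, ← IsScalarTower.algebraMap_apply N K F,
      ← IsScalarTower.algebraMap_apply N A F]
  have : FaithfulSMul A L := FaithfulSMul.trans A F L
  have : FaithfulSMul N L := FaithfulSMul.trans N A L
  let C := integralClosure N L
  let f : A →ₐ[N] C := IsIntegralClosure.lift N C L
  let : Algebra A C := f.toAlgebra
  have : IsScalarTower N A C := IsScalarTower.of_algHom f
  have : FaithfulSMul A C := (faithfulSMul_iff_algebraMap_injective _ _).2 fun x y h =>
    FaithfulSMul.algebraMap_injective A L <| by
      rw [← IsIntegralClosure.algebraMap_lift N C L x, ← IsIntegralClosure.algebraMap_lift N C L y]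
      exact congrArg (algebraMap C L) h
  have : FaithfulSMul N C := FaithfulSMul.trans N A C
  have : Algebra.IsIntegral A C := Algebra.IsIntegral.tower_top N
  have : IsFractionRing C L := integralClosure.isFractionRing_of_finite_extension K L
  let := IsIntegralClosure.MulSemiringAction N K L C
  have := Algebra.isInvariant_of_isGalois N K L C
  have : SMulCommClass Gal(L/K) N C := ⟨fun g n c => by
    change galRestrict N K L C g (n • c) = n • galRestrict N K L C g c
    exact map_smul _ _ _⟩
  refine ⟨fun {p hp} Q hQ hlt => ?_⟩
  obtain ⟨M, hM, hMQ⟩ := Ideal.exists_ideal_over_prime_of_isIntegral_of_isDomain (S := C) Q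
    (by rw [(RingHom.injective_iff_ker_eq_bot _).1 (FaithfulSMul.algebraMap_injective A C)]
        exact bot_le)
  have : M.LiesOver Q := ⟨hMQ.symm⟩
  have : M.LiesOver (Q.under N) := Ideal.LiesOver.trans M Q (Q.under N)
  obtain ⟨P, hPM, hP, hPp⟩ :=
    Ideal.exists_le_liesOver_of_isInvariant Gal(L/K) hlt.le M
  have hPo := P.over_def p
  refine ⟨P.under A, ?_, inferInstance, ⟨?_⟩⟩
  · rw [← hMQ]
    exact Ideal.comap_mono hPM
  · rw [Ideal.under_under, ← hPo]

/-- Every maximal ideal of a polynomial ring in `n` variables has height `n`. -/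
theorem MvPolynomial.height_of_isMaximal {k : Type*} [Field k] [IsAlgClosed k] {n : ℕ}
    (m : Ideal (MvPolynomial (Fin n) k)) [hm : m.IsMaximal] : m.height = n := by
  have hdim : ringKrullDim (MvPolynomial (Fin n) k) = n := by
    simp [MvPolynomial.ringKrullDim_of_isNoetherianRing]
  have : FiniteRingKrullDim (MvPolynomial (Fin n) k) :=
    finiteRingKrullDim_iff_ne_bot_and_top.2 (by
      rw [hdim]
      exact ⟨WithBot.coe_ne_bot, fun h => ENat.natCast_ne_top n (WithBot.coe_injective h)⟩)
  obtain ⟨p, hp, hpd⟩ := Ideal.exists_isMaximal_height (R := MvPolynomial (Fin n) k)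
  rw [hdim] at hpd
  obtain ⟨x, rfl⟩ := MvPolynomial.eq_vanishingIdeal_singleton_of_isMaximal k hm
  obtain ⟨y, rfl⟩ := MvPolynomial.eq_vanishingIdeal_singleton_of_isMaximal k hp
  let t (a : Fin n → k) : MvPolynomial (Fin n) k →ₐ[k] MvPolynomial (Fin n) k :=
    MvPolynomial.aeval fun i => MvPolynomial.X i + MvPolynomial.C (a i)
  have ht (a b : Fin n → k) (hab : ∀ i, a i + b i = 0) : (t a).comp (t b) = AlgHom.id _ _ := by
    ext1 i
    have : MvPolynomial.C (a i) + MvPolynomial.C (b i) = (0 : MvPolynomial (Fin n) k) := by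
      rw [← map_add, hab, map_zero]
    simp only [AlgHom.comp_apply, t, MvPolynomial.aeval_X, map_add, MvPolynomial.algHom_C,
      MvPolynomial.algebraMap_eq, AlgHom.id_apply]
    rw [add_assoc, this, add_zero]
  let e := AlgEquiv.ofAlgHom (t (x - y)) (t (y - x)) (ht _ _ (by simp)) (ht _ _ (by simp))
  have he : (MvPolynomial.vanishingIdeal k {y}).comap (e : _ ≃+* MvPolynomial (Fin n) k) =
      MvPolynomial.vanishingIdeal k {x} := by
    ext p
    have : (MvPolynomial.aeval y).comp (t (x - y)) = MvPolynomial.aeval (R := k) x := by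
      ext i
      simp [t]
    have := congrArg (fun f => f p) this
    simp only [AlgHom.comp_apply] at this
    rw [Ideal.mem_comap, MvPolynomial.mem_vanishingIdeal_singleton_iff,
      MvPolynomial.mem_vanishingIdeal_singleton_iff, ← this]
    rfl
  rw [← he, RingEquiv.height_comap]
  exact_mod_cast hpd

/-- Noether normalization, with the equidimensionality of affine domains. -/
theorem exists_noether_normalization_height (k A : Type*) [Field k] [IsAlgClosed k] [CharZero k]
    [CommRing A] [IsDomain A] [Algebra k A] [Algebra.FiniteType k A] :
    ∃ (n : ℕ) (g : MvPolynomial (Fin n) k →ₐ[k] A), Function.Injective g ∧ g.IsIntegral ∧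
      ringKrullDim A = n ∧ ∀ m : Ideal A, m.IsMaximal → m.height = n := by
  obtain ⟨n, g, hinj, hfin⟩ := exists_finite_inj_algHom_of_fg k A
  have : IsNoetherianRing A := Algebra.FiniteType.isNoetherianRing k A
  refine ⟨n, g, hinj, hfin.to_isIntegral, ?_⟩
  let : Algebra (MvPolynomial (Fin n) k) A := g.toRingHom.toAlgebra
  have : Module.Finite (MvPolynomial (Fin n) k) A := hfin
  have : FaithfulSMul (MvPolynomial (Fin n) k) A :=
    (faithfulSMul_iff_algebraMap_injective _ _).2 hinj
  have := Algebra.HasGoingDown.of_isIntegrallyClosed (MvPolynomial (Fin n) k) A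
  have hge (m : Ideal A) (hm : m.IsMaximal) : (n : ℕ∞) ≤ m.height := by
    have := Ideal.isMaximal_comap_of_isIntegral_of_isMaximal (R := MvPolynomial (Fin n) k) m
    rw [← MvPolynomial.height_of_isMaximal (m.comap (algebraMap (MvPolynomial (Fin n) k) A)),
      Ideal.height_eq_height_add_of_liesOver_of_hasGoingDown
        (m.comap (algebraMap (MvPolynomial (Fin n) k) A)) m]
    exact le_self_add
  have hle : ringKrullDim A ≤ n := by
    have : StrictMono (PrimeSpectrum.comap (algebraMap (MvPolynomial (Fin n) k) A)) :=
      fun p q h => Ideal.IsIntegral.comap_lt_comap h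
    refine (Order.krullDim_le_of_strictMono _ this).trans ?_
    change ringKrullDim _ ≤ _
    simp [MvPolynomial.ringKrullDim_of_isNoetherianRing]
  have hle' (m : Ideal A) (hm : m.IsMaximal) : m.height = n := by
    refine le_antisymm ?_ (hge m hm)
    exact_mod_cast Ideal.height_le_ringKrullDim_of_isPrime.trans hle
  refine ⟨le_antisymm hle ?_, hle'⟩
  obtain ⟨m, hm⟩ := Ideal.exists_maximal A
  have := Ideal.height_le_ringKrullDim_of_isPrime (I := m)
  rwa [hle' m hm] at this

/-- If a maximal ideal is isolated in its fibre over a subalgebra, the dimension of the subalgebra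
is at least that of the algebra. -/
theorem ringKrullDim_le_of_isolated_in_fibre (k : Type*) {A B : Type*} [Field k] [IsAlgClosed k]
    [CharZero k] [CommRing A] [IsDomain A] [Algebra k A] [Algebra.FiniteType k A] [CommRing B]
    [IsNoetherianRing B] [Algebra B A] (m : Ideal A) [hm : m.IsMaximal]
    (h : ∀ q : Ideal A, q.IsPrime → q ≤ m → (m.under B).map (algebraMap B A) ≤ q → q = m) :
    ringKrullDim A ≤ ringKrullDim B := by
  have : IsNoetherianRing A := Algebra.FiniteType.isNoetherianRing k A
  obtain ⟨n, -, -, -, hn, hmn⟩ := exists_noether_normalization_height k A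
  have hle := Ideal.height_le_height_add_of_liesOver (m.under B) m
  set J := (m.under B).map (algebraMap B A) with hJ
  have hJm : J ≤ m := Ideal.map_comap_le
  have hmax : (m.map (Ideal.Quotient.mk J)).IsPrime :=
    Ideal.map_isPrime_of_surjective Ideal.Quotient.mk_surjective (by simpa using hJm)
  have h0 : (m.map (Ideal.Quotient.mk J)).height = 0 := by
    rw [Ideal.height_eq_zero_iff]
    refine ⟨⟨hmax, bot_le⟩, fun q hq hqm => ?_⟩
    have := h (q.comap (Ideal.Quotient.mk J)) (hq.1.comap _) ?_ ?_
    · rw [← this, Ideal.map_comap_of_surjective _ Ideal.Quotient.mk_surjective]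
    · refine (Ideal.comap_mono hqm).trans ?_
      rw [Ideal.comap_map_of_surjective _ Ideal.Quotient.mk_surjective]
      simpa [← RingHom.ker_eq_comap_bot] using hJm
    · intro x hx
      simp [Ideal.mem_comap, Ideal.Quotient.eq_zero_iff_mem.2 hx]
  rw [h0, add_zero, hmn m hm] at hle
  rw [hn]
  refine le_trans ?_ (Ideal.height_le_ringKrullDim_of_isPrime (I := m.under B))
  exact_mod_cast hle

/-- A domain generated by `l` subalgebras of dimension at most `r` has dimension at most `l * r`. -/
theorem ringKrullDim_le_mul_of_iSup_range_eq_top {k B : Type*} [Field k] [IsAlgClosed k]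
    [CharZero k] [CommRing B] [IsDomain B] [Algebra k B] [Algebra.FiniteType k B] {l r : ℕ}
    (A : Fin l → Subalgebra k B) [∀ i, Algebra.FiniteType k (A i)] (htop : ⨆ i, A i = ⊤)
    (hr : ∀ i, ringKrullDim (A i) ≤ r) : ringKrullDim B ≤ (l * r : ℕ) := by
  choose n g hinj hgint hdim _ using fun i => exists_noether_normalization_height k (A i)
  have hnr (i) : n i ≤ r := by
    have := (hdim i).symm.trans_le (hr i)
    exact_mod_cast this
  let x : (Σ i, Fin (n i)) → B := fun j => g j.1 (MvPolynomial.X j.2)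
  let D := Algebra.adjoin k (Set.range x)
  have halg : Algebra.IsIntegral D B := by
    have hle : (⨆ i, A i) ≤ (integralClosure D B).restrictScalars k := by
      refine iSup_le fun i a ha => ?_
      have hmem (p) : ((g i p : A i) : B) ∈ D := by
        induction p using MvPolynomial.induction_on with
        | C c => simp [D.algebraMap_mem c]
        | add p q hp hq => simpa using add_mem hp hq
        | mul_X p j hp =>
          simpa using mul_mem hp
            (Algebra.subset_adjoin (Set.mem_range_self (⟨i, j⟩ : Σ i, Fin (n i))))
      let f : MvPolynomial (Fin (n i)) k →+* D :=
        (((A i).val.comp (g i)).codRestrict D hmem : _ →ₐ[k] D)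
      have h1 : ((A i).val.toRingHom.comp (g i).toRingHom).IsIntegralElem a :=
        (hgint i ⟨a, ha⟩).map (A i).val.toRingHom
      obtain ⟨P, hP, hPa⟩ := h1
      exact ⟨P.map f, hP.map _, by rw [Polynomial.eval₂_map]; exact hPa⟩
    rw [htop] at hle
    exact ⟨fun b => hle (Algebra.mem_top (x := b))⟩
  obtain ⟨N, gN, hNinj, -, hN, -⟩ := exists_noether_normalization_height k B
  have hind : AlgebraicIndependent k (fun i => gN (MvPolynomial.X i)) := by
    rw [algebraicIndependent_iff_injective_aeval]
    convert! hNinj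
    ext i; simp
  rw [hN]
  have h1 := hind.lift_cardinalMk_le_trdeg
  have h2 : Algebra.trdeg k B ≤ Cardinal.mk (Set.range x) :=
    Algebra.IsAlgebraic.trdeg_le_cardinalMk k (Set.range x)
  have h3 := Cardinal.mk_range_le_lift (f := x)
  have h4 : ∑ i, n i ≤ l * r := by
    simpa using Finset.sum_le_card_nsmul Finset.univ n r fun i _ => hnr i
  simp at h1 h3
  have h5 := h1.trans (h2.trans h3)
  rw [← Nat.cast_sum, Cardinal.lift_natCast] at h5
  have h6 : N ≤ ∑ i, n i := by exact_mod_cast h5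
  exact_mod_cast h6.trans h4

section Zariski

variable {S : Type*}

theorem flatten_injective : Function.Injective (flatten (S := S)) := by
  intro Q Q' h
  ext s
  · simpa [flatten] using congrFun h (s, 0)
  · simpa [flatten] using congrFun h (s, 1)

theorem flatten_surjective : Function.Surjective (flatten (S := S)) := by
  intro x
  refine ⟨fun s => (x (s, 0), x (s, 1)), ?_⟩
  ext ⟨s, j⟩
  fin_cases j <;> simp [flatten]

/-- The ideal of polynomials vanishing on a set of tuples. -/
def idealOf (V : Set (S → ℂ × ℂ)) : Ideal (MvPolynomial (S × Fin 2) ℂ) :=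
  vanishingIdeal ℂ (flatten '' V)

/-- The set of tuples at which all polynomials in an ideal vanish. -/
def locus (I : Ideal (MvPolynomial (S × Fin 2) ℂ)) : Set (S → ℂ × ℂ) :=
  flatten ⁻¹' zeroLocus ℂ I

theorem mem_idealOf {V : Set (S → ℂ × ℂ)} {f : MvPolynomial (S × Fin 2) ℂ} :
    f ∈ idealOf V ↔ ∀ Q ∈ V, eval (flatten Q) f = 0 := by
  simp [idealOf, MvPolynomial.mem_vanishingIdeal_iff]

theorem mem_locus {I : Ideal (MvPolynomial (S × Fin 2) ℂ)} {Q : S → ℂ × ℂ} :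
    Q ∈ locus I ↔ ∀ f ∈ I, eval (flatten Q) f = 0 := by
  simp [locus]

theorem idealOf_anti {V W : Set (S → ℂ × ℂ)} (h : V ⊆ W) : idealOf W ≤ idealOf V :=
  vanishingIdeal_anti_mono (Set.image_mono h)

theorem locus_anti {I J : Ideal (MvPolynomial (S × Fin 2) ℂ)} (h : I ≤ J) : locus J ⊆ locus I :=
  Set.preimage_mono (zeroLocus_anti_mono h)

theorem zClosed_locus (I : Ideal (MvPolynomial (S × Fin 2) ℂ)) : ZClosed (locus I) :=
  ⟨I, by ext; simp [mem_locus]⟩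

theorem ZClosed.locus_idealOf {V : Set (S → ℂ × ℂ)} (h : ZClosed V) : locus (idealOf V) = V := by
  obtain ⟨I, rfl⟩ := h
  refine Set.Subset.antisymm (fun Q hQ f hf => ?_) fun Q hQ => mem_locus.2 fun f hf => ?_
  · exact mem_locus.1 hQ f (mem_idealOf.2 fun Q' hQ' => hQ' f hf)
  · exact mem_idealOf.1 hf Q hQ

theorem ZIrred.isPrime_idealOf {V : Set (S → ℂ × ℂ)} (h : ZIrred V) : (idealOf V).IsPrime := by
  obtain ⟨-, ⟨Q, hQ⟩, hirr⟩ := h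
  refine ⟨fun htop => ?_, fun {f g} hfg => ?_⟩
  · have : (1 : MvPolynomial (S × Fin 2) ℂ) ∈ idealOf V := htop ▸ Submodule.mem_top
    simpa using mem_idealOf.1 this Q hQ
  · have key := hirr {Q | ∀ p ∈ ({f} : Set _), eval (flatten Q) p = 0}
      {Q | ∀ p ∈ ({g} : Set _), eval (flatten Q) p = 0} ⟨_, rfl⟩ ⟨_, rfl⟩ fun Q hQ => by
        simpa using mem_idealOf.1 hfg Q hQ
    exact key.imp (fun h => mem_idealOf.2 fun Q hQ => h hQ f rfl)
      (fun h => mem_idealOf.2 fun Q hQ => h hQ g rfl)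

theorem zDimLE_of_ringKrullDim_quotient_le {V : Set (S → ℂ × ℂ)} {r : ℕ}
    (h : ringKrullDim (MvPolynomial (S × Fin 2) ℂ ⧸ idealOf V) ≤ r) : ZDimLE V r := by
  intro k c hc hcV hmono
  rw [ringKrullDim_quotient] at h
  let l : LTSeries (PrimeSpectrum.zeroLocus (idealOf V : Set (MvPolynomial (S × Fin 2) ℂ))) :=
    LTSeries.mk k (fun i => ⟨⟨idealOf (c i.rev), (hc _).isPrime_idealOf⟩, idealOf_anti (hcV _)⟩)
      fun i j hij => by
        have hlt := hmono (Fin.rev_lt_rev.2 hij)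
        refine lt_of_le_not_ge (idealOf_anti hlt.le) fun hle => hlt.not_ge ?_
        have := locus_anti hle
        rwa [(hc _).1.locus_idealOf, (hc _).1.locus_idealOf] at this
  have := (Order.LTSeries.length_le_krullDim l).trans h
  exact_mod_cast this

variable [Finite S]

theorem idealOf_locus (p : Ideal (MvPolynomial (S × Fin 2) ℂ)) [p.IsPrime] :
    idealOf (locus p) = p := by
  rw [idealOf, locus, Set.image_preimage_eq _ flatten_surjective, IsPrime.vanishingIdeal_zeroLocus]

theorem zIrred_locus (p : Ideal (MvPolynomial (S × Fin 2) ℂ)) [hp : p.IsPrime] :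
    ZIrred (locus p) := by
  refine ⟨zClosed_locus p, Set.nonempty_iff_ne_empty.2 fun h => ?_, fun V₁ V₂ h₁ h₂ h => ?_⟩
  · refine hp.ne_top ?_
    rw [← idealOf_locus p, h, idealOf, Set.image_empty, vanishingIdeal_empty]
  · by_contra! hcon
    have hex {V : Set (S → ℂ × ℂ)} (hV : ZClosed V) (hn : ¬ locus p ⊆ V) :
        ∃ f ∈ idealOf V, f ∉ p := by
      refine Set.not_subset.1 fun hle => hn ?_
      rw [← hV.locus_idealOf]
      exact locus_anti hle
    obtain ⟨f, hf, hfp⟩ := hex h₁ hcon.1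
    obtain ⟨g, hg, hgp⟩ := hex h₂ hcon.2
    have : f * g ∈ p := by
      rw [← idealOf_locus p, mem_idealOf]
      intro Q hQ
      rcases h hQ with hQ | hQ
      · simp [mem_idealOf.1 hf Q hQ]
      · simp [mem_idealOf.1 hg Q hQ]
    exact (hp.mem_or_mem this).elim hfp hgp

/-- Every irreducible subset of `K` lies in an irreducible component of `K`. -/
theorem ZIrred.exists_isIrredComponent {K W : Set (S → ℂ × ℂ)} (hK : ZClosed K) (hW : ZIrred W)
    (h : W ⊆ K) : ∃ V, IsIrredComponent K V ∧ W ⊆ V := by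
  have := hW.isPrime_idealOf
  obtain ⟨p, hp, hpW⟩ := Ideal.exists_minimalPrimes_le (idealOf_anti h)
  have := hp.1.1
  refine ⟨locus p, ⟨zIrred_locus p, ?_, fun W' hW' hW'K hle => ?_⟩, ?_⟩
  · exact hK.locus_idealOf ▸ locus_anti hp.1.2
  · have h1 := idealOf_anti hle
    rw [idealOf_locus] at h1
    have h2 := hp.2 ⟨hW'.isPrime_idealOf, idealOf_anti hW'K⟩ h1
    rw [← hW'.1.locus_idealOf, le_antisymm h1 h2]
  · exact hW.1.locus_idealOf ▸ locus_anti hpW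

theorem ZDimLE.ringKrullDim_quotient_le {V : Set (S → ℂ × ℂ)} {r : ℕ} (h : ZDimLE V r)
    {I : Ideal (MvPolynomial (S × Fin 2) ℂ)} (hI : locus I ⊆ V) :
    ringKrullDim (MvPolynomial (S × Fin 2) ℂ ⧸ I) ≤ r := by
  rw [ringKrullDim_quotient]
  refine iSup_le fun l => ?_
  have := h l.length (fun i => locus (l i.rev).1.asIdeal) (fun i => zIrred_locus _)
    (fun i => (locus_anti (l i.rev).2).trans hI) fun i j hij => ?_
  · exact_mod_cast this
  · have hlt : (l j.rev).1.asIdeal < (l i.rev).1.asIdeal := l.strictMono (Fin.rev_lt_rev.2 hij)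
    refine lt_of_le_not_ge (locus_anti hlt.le) fun hle => hlt.not_ge ?_
    simpa [idealOf_locus] using idealOf_anti hle

end Zariski

theorem collinear_image_iff {S : Type*} (Q : S → ℂ × ℂ) (t : Set S) :
    Collinear ℂ (Q '' t) ↔ ∀ a ∈ t, ∀ b ∈ t, ∀ c ∈ t,
      ((Q b).1 - (Q a).1) * ((Q c).2 - (Q a).2) - ((Q b).2 - (Q a).2) * ((Q c).1 - (Q a).1) = 0 := by
  constructor
  · intro h a ha b hb c hc
    obtain ⟨v, hv⟩ := (collinear_iff_of_mem (Set.mem_image_of_mem Q ha)).1 h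
    obtain ⟨x, hx⟩ := hv _ (Set.mem_image_of_mem Q hb)
    obtain ⟨y, hy⟩ := hv _ (Set.mem_image_of_mem Q hc)
    rw [hx, hy]
    simp
    ring
  · intro h
    obtain rfl | ⟨a, ha⟩ := t.eq_empty_or_nonempty
    · simpa using collinear_empty ℂ (ℂ × ℂ)
    rw [collinear_iff_of_mem (Set.mem_image_of_mem Q ha)]
    by_cases hall : ∀ b ∈ t, Q b = Q a
    · refine ⟨0, ?_⟩
      rintro _ ⟨b, hb, rfl⟩
      exact ⟨0, by simp [hall b hb]⟩
    · push Not at hall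
      obtain ⟨b, hb, hba⟩ := hall
      refine ⟨Q b - Q a, ?_⟩
      rintro _ ⟨c, hc, rfl⟩
      have habc := h a ha b hb c hc
      by_cases h1 : (Q b).1 = (Q a).1
      · have h2 : (Q b).2 - (Q a).2 ≠ 0 := fun h2 => hba (Prod.ext h1 (sub_eq_zero.1 h2))
        have h3 : (Q c).1 = (Q a).1 := by
          simpa [h1, h2, sub_eq_zero] using habc
        refine ⟨((Q c).2 - (Q a).2) / ((Q b).2 - (Q a).2), Prod.ext ?_ ?_⟩
        · simp [h1, h3]
        · simp [h2]
      · have h2 : (Q b).1 - (Q a).1 ≠ 0 := sub_ne_zero.2 h1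
        refine ⟨((Q c).1 - (Q a).1) / ((Q b).1 - (Q a).1), Prod.ext ?_ ?_⟩
        · simp [h2]
        · simp
          field_simp
          linear_combination habc

theorem zClosed_KT {S : Type*} (T : Set (Set S)) : ZClosed (KT T) := by
  refine ⟨{f | ∃ t ∈ T, ∃ a ∈ t, ∃ b ∈ t, ∃ c ∈ t,
    f = (X (b, 0) - X (a, 0)) * (X (c, 1) - X (a, 1)) -
      (X (b, 1) - X (a, 1)) * (X (c, 0) - X (a, 0))}, ?_⟩
  ext Q
  simp only [KT, collinear_image_iff, Set.mem_ofPred_eq]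
  constructor
  · rintro h _ ⟨t, ht, a, ha, b, hb, c, hc, rfl⟩
    simpa [flatten] using h t ht a ha b hb c hc
  · intro h t ht a ha b hb c hc
    simpa [flatten] using h _ ⟨t, ht, a, ha, b, hb, c, hc, rfl⟩

section Restriction

variable {S : Type*} {U : Set S}

/-- The inclusion of the coordinate ring of `(ℂ²)^U` into that of `(ℂ²)^S`. -/
def extendCoords (U : Set S) : MvPolynomial (U × Fin 2) ℂ →ₐ[ℂ] MvPolynomial (S × Fin 2) ℂ :=
  rename (Prod.map Subtype.val id)

theorem eval_extendCoords (Q : S → ℂ × ℂ) (f : MvPolynomial (U × Fin 2) ℂ) :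
    eval (flatten Q) (extendCoords U f) = eval (flatten fun s : U => Q s) f := by
  rw [extendCoords, eval_rename]
  rfl

theorem restrict_mem_KT {T : Set (Set S)} {Q : S → ℂ × ℂ} (hQ : Q ∈ KT T) :
    (fun s : U => Q s) ∈ KT {t : Set U | Subtype.val '' t ∈ T} := by
  intro t ht
  simpa [Set.image_image] using hQ _ ht

/-- The coordinate ring of the closure of the projection to `(ℂ²)^U` of a variety through `P` has
dimension at most `r`, as soon as the restriction of `P` to `U` is `r`-rigid. -/
theorem IsRigid.ringKrullDim_comap_le [Finite S] {T : Set (Set S)} {P : S → ℂ × ℂ} {r : ℕ}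
    (h : IsRigid {t : Set U | Subtype.val '' t ∈ T} (fun s : U => P s) r)
    {V : Set (S → ℂ × ℂ)} (hV : ZIrred V) (hVK : V ⊆ KT T) (hPV : P ∈ V) :
    ringKrullDim (MvPolynomial (U × Fin 2) ℂ ⧸ (idealOf V).comap (extendCoords U)) ≤ r := by
  have := hV.isPrime_idealOf
  set J := (idealOf V).comap (extendCoords U) with hJ
  have hJK : locus J ⊆ KT {t : Set U | Subtype.val '' t ∈ T} := by
    rw [← (zClosed_KT {t : Set U | Subtype.val '' t ∈ T}).locus_idealOf]
    refine locus_anti fun f hf => mem_idealOf.2 fun Q hQ => ?_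
    rw [eval_extendCoords]
    exact mem_idealOf.1 hf _ (restrict_mem_KT (hVK hQ))
  have hPJ : (fun s : U => P s) ∈ locus J := mem_locus.2 fun f hf => by
    rw [← eval_extendCoords]
    exact mem_idealOf.1 hf P hPV
  obtain ⟨W, hW, hJW⟩ := (zIrred_locus J).exists_isIrredComponent (zClosed_KT _) hJK
  exact (h.2 W hW (hJW hPJ)).ringKrullDim_quotient_le hJW

end Restriction

/-- If `S₁, …, S_ℓ` are disjoint subsets of `S`, each restricted tuple `P_i` is
`r`-rigid with respect to `T_i = T ∩ (Sᵢ choose 3)`, and `P` is the unique point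
of `K_T` restricting to the `P_i`'s, then `P` is `(ℓ·r)`-rigid with respect
to `T`. -/
theorem fullrigid {S : Type*} [Fintype S] (ℓ r : ℕ)
    (Si : Fin ℓ → Set S) (hdisj : Pairwise (Function.onFun Disjoint Si))
    (T : Set (Set S)) (hT3 : ∀ t ∈ T, t.ncard = 3)
    (P : S → ℂ × ℂ) (hP : P ∈ KT T)
    (hrigid : ∀ i : Fin ℓ,
      IsRigid {t : Set ↥(Si i) | Subtype.val '' t ∈ T}
        (fun s : ↥(Si i) => P s.val) r)
    (huniq : ∀ P' ∈ KT T, (∀ (i : Fin ℓ), ∀ s ∈ Si i, P' s = P s) → P' = P) :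
    IsRigid T P (ℓ * r) := by
  refine ⟨hP, fun V hV hPV => ?_⟩
  have hprime := hV.1.isPrime_idealOf
  have hsub (i : Fin ℓ) := (hrigid i).ringKrullDim_comap_le hV.1 hV.2.1 hPV
  set I := idealOf V with hI
  refine zDimLE_of_ringKrullDim_quotient_le ?_
  let e : (Σ i, Si i × Fin 2) → S × Fin 2 := fun v => (v.2.1, v.2.2)
  let Φ : MvPolynomial (Σ i, Si i × Fin 2) ℂ →ₐ[ℂ] MvPolynomial (S × Fin 2) ℂ ⧸ I :=
    (Ideal.Quotient.mkₐ ℂ I).comp (rename e)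
  let B := Φ.range
  let ψ (i : Fin ℓ) : MvPolynomial (Si i × Fin 2) ℂ →ₐ[ℂ] B :=
    Φ.rangeRestrict.comp (rename (fun v => (⟨i, v⟩ : Σ i, Si i × Fin 2)))
  have hψ (i : Fin ℓ) (f) : (ψ i f : MvPolynomial (S × Fin 2) ℂ ⧸ I) =
      Ideal.Quotient.mk I (extendCoords (Si i) f) := by
    change Ideal.Quotient.mk I (rename e (rename (fun v => (⟨i, v⟩ : Σ i, Si i × Fin 2)) f)) = _
    rw [rename_rename]
    rfl
  have hker (i : Fin ℓ) : RingHom.ker (ψ i) = I.comap (extendCoords (Si i)) := by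
    ext f
    rw [RingHom.mem_ker, Ideal.mem_comap, ← Ideal.Quotient.eq_zero_iff_mem, ← hψ,
      ZeroMemClass.coe_eq_zero]
  have hdim (i : Fin ℓ) : ringKrullDim (ψ i).range ≤ r := by
    refine le_trans (le_of_eq ?_) (hker i ▸ hsub i)
    exact (ringKrullDim_eq_of_ringEquiv (Ideal.quotientKerEquivRange (ψ i)).toRingEquiv).symm
  have htop : ⨆ i, (ψ i).range = ⊤ := by
    refine eq_top_iff.2 ?_
    rw [← (AlgHom.range_eq_top _).2 Φ.rangeRestrict_surjective, ← Algebra.map_top,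
      ← adjoin_range_X, AlgHom.map_adjoin, Algebra.adjoin_le_iff]
    rintro _ ⟨_, ⟨⟨i, v⟩, rfl⟩, rfl⟩
    exact le_iSup (fun i => (ψ i).range) i ⟨X v, by simp [ψ]⟩
  have : Algebra.FiniteType ℂ B := .of_surjective Φ.rangeRestrict Φ.rangeRestrict_surjective
  have (i : Fin ℓ) : Algebra.FiniteType ℂ (ψ i).range :=
    .of_surjective (ψ i).rangeRestrict (ψ i).rangeRestrict_surjective
  have : IsNoetherianRing B := Algebra.FiniteType.isNoetherianRing ℂ B
  refine le_trans ?_ (ringKrullDim_le_mul_of_iSup_range_eq_top _ htop hdim)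
  have hIP : I ≤ vanishingIdeal ℂ {flatten P} := fun f hf =>
    (mem_vanishingIdeal_singleton_iff _ _).2 (by simpa using mem_idealOf.1 hf P hPV)
  have hmax : ((vanishingIdeal ℂ {flatten P}).map (Ideal.Quotient.mk I)).IsMaximal :=
    Ideal.IsMaximal.map_of_surjective_of_ker_le Ideal.Quotient.mk_surjective (by simpa using hIP)
  refine ringKrullDim_le_of_isolated_in_fibre ℂ
    ((vanishingIdeal ℂ {flatten P}).map (Ideal.Quotient.mk I)) fun q hq hqm hBq =>
      le_antisymm hqm ?_
  have hqI : I ≤ q.comap (Ideal.Quotient.mk I) := fun f hf => by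
    simp [Ideal.mem_comap, Ideal.Quotient.eq_zero_iff_mem.2 hf]
  have hlocus : locus (q.comap (Ideal.Quotient.mk I)) ⊆ {P} := by
    intro Q hQ
    have hQV : Q ∈ V := hV.1.1.locus_idealOf ▸ locus_anti hqI hQ
    refine huniq Q (hV.2.1 hQV) fun i s hs => ?_
    have hcoord (j : Fin 2) : flatten Q (s, j) = flatten P (s, j) := by
      let b : B := ψ i (X (⟨s, hs⟩, j) - C (flatten P (s, j)))
      have hb : (b : MvPolynomial (S × Fin 2) ℂ ⧸ I) =
          Ideal.Quotient.mk I (X (s, j) - C (flatten P (s, j))) := by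
        rw [hψ]
        simp [extendCoords]
      have hbq : (b : MvPolynomial (S × Fin 2) ℂ ⧸ I) ∈ q := by
        refine hBq (Ideal.mem_map_of_mem (algebraMap B (MvPolynomial (S × Fin 2) ℂ ⧸ I)) (x := b) ?_)
        change (b : MvPolynomial (S × Fin 2) ℂ ⧸ I) ∈ Ideal.map _ _
        rw [hb]
        exact Ideal.mem_map_of_mem _ ((mem_vanishingIdeal_singleton_iff _ _).2 (by simp))
      rw [hb] at hbq
      simpa [sub_eq_zero] using mem_locus.1 hQ _ hbq
    exact Prod.ext (by simpa [flatten] using hcoord 0) (by simpa [flatten] using hcoord 1)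
  rw [Ideal.map_le_iff_le_comap, ← idealOf_locus (q.comap (Ideal.Quotient.mk I))]
  refine le_trans ?_ (idealOf_anti hlocus)
  rw [idealOf, Set.image_singleton]
end
end

section
/- For every C > 0 there exist constants c > 0 and a positive integer r, depending only on C, with the following property. Let P be a set of n points in ℝ² determining at least C·n² consecutive collinear triples. Then there exist a subset P' ⊆ P with |P'| ≥ c·n and a collection T' of at least c·n² triples of points of P', each of which is a consecutive collinear triple of P, such that P' is r-rigid with respect to T' (one may take r = ⌈32/C⌉). -/
noncomputable section

open MvPolynomial

/-- The natural embedding `ℝ² ⊆ ℂ²`. -/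
def emb (p : ℝ × ℝ) : ℂ × ℂ := ((p.1 : ℂ), (p.2 : ℂ))

/-- `x, y, z` form a consecutive collinear triple of `P`: `y` lies strictly
between `x` and `z`, and no other point of `P` lies strictly between `x`
and `z`. -/
def ConsecTriple (P : Set (ℝ × ℝ)) (x y z : ℝ × ℝ) : Prop :=
  x ∈ P ∧ y ∈ P ∧ z ∈ P ∧ Sbtw ℝ x y z ∧ ∀ w ∈ P, Sbtw ℝ x w z → w = y

/-- The set of (unordered) consecutive collinear triples of `P`. -/
def ConsecTriples (P : Set (ℝ × ℝ)) : Set (Set (ℝ × ℝ)) :=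
  {u : Set (ℝ × ℝ) | ∃ x y z : ℝ × ℝ, u = {x, y, z} ∧ ConsecTriple P x y z}

section Scaling

open Module Submodule
open scoped RealInnerProductSpace

variable {E : Type*} [NormedAddCommGroup E] [InnerProductSpace ℝ E]

/-- A positive definite symmetric operator on a real inner product space. -/
structure PosSym (Q : E →L[ℝ] E) : Prop where
  symm : ∀ x y, ⟪Q x, y⟫ = ⟪x, Q y⟫
  pos : ∀ x, x ≠ 0 → 0 < ⟪Q x, x⟫

/-- The operator `Q - s • (Q x) ⊗ (Q x)`. -/
def shrink (Q : E →L[ℝ] E) (x : E) (s : ℝ) : E →L[ℝ] E :=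
  Q - s • (innerSL ℝ (Q x)).smulRight (Q x)

lemma shrink_inner (Q : E →L[ℝ] E) (x : E) (s : ℝ) (u v : E) :
    ⟪shrink Q x s u, v⟫ = ⟪Q u, v⟫ - s * (⟪Q x, u⟫ * ⟪Q x, v⟫) := by
  simp [shrink, inner_sub_left, inner_smul_left]

/-- The vectors orthogonal to `b k` for all `k < j`. -/
def tailSpace {m : ℕ} (b : Fin m → E) (j : Fin m) : Submodule ℝ E :=
  ⨅ k : Fin m, ⨅ _ : k < j, LinearMap.ker (innerₛₗ ℝ (b k))

lemma mem_tailSpace {m : ℕ} {b : Fin m → E} {j : Fin m} {x : E} :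
    x ∈ tailSpace b j ↔ ∀ k < j, ⟪b k, x⟫ = 0 := by
  simp [tailSpace, Submodule.mem_iInf]

/-- `Q` is diagonal in the frame `b` with eigenvalues `l`. -/
def DiagIn {m : ℕ} (Q : E →L[ℝ] E) (b : Fin m → E) (l : Fin m → ℝ) : Prop :=
  ∀ u v, ⟪Q u, v⟫ = ∑ k, l k * (⟪b k, u⟫ * ⟪b k, v⟫)

/-- `F Q` behaves like the squared volume form of `Q` restricted to `U`. -/
structure IsVolForm (U : Submodule ℝ E) (F : (E →L[ℝ] E) → ℝ) : Prop where
  cont : Continuous F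
  pos : ∀ Q, PosSym Q → 0 < F Q
  deriv : ∀ Q, PosSym Q → ∀ x, ∃ π : ℝ, (∀ s, F (shrink Q x s) = F Q * (1 - s * π)) ∧
    ∀ u ∈ U, ⟪Q u, x⟫ ^ 2 ≤ π * ⟪Q u, u⟫
  greedy : ∀ {m : ℕ} (b₀ : Fin m → E), (∀ x, (∀ k, ⟪b₀ k, x⟫ = 0) → x = 0) →
    ∃ N : Fin m → ℕ,
      (∀ j, ∑ k with j ≤ k, N k ≤ finrank ℝ ↥(U ⊓ tailSpace b₀ j)) ∧
      ∃ c > 0, ∀ᶠ b in nhds b₀, ∀ (l : Fin m → ℝ) (Q : E →L[ℝ] E), (∀ k, 0 < l k) →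
        DiagIn Q b l → c * ∏ k, l k ^ N k ≤ F Q

lemma PosSym.symm' {Q : E →L[ℝ] E} (hQ : PosSym Q) (x y : E) : ⟪Q x, y⟫ = ⟪Q y, x⟫ := by
  rw [hQ.symm, real_inner_comm]

lemma PosSym.nonneg {Q : E →L[ℝ] E} (hQ : PosSym Q) (x : E) : 0 ≤ ⟪Q x, x⟫ := by
  by_cases h : x = 0
  · simp [h]
  · exact (hQ.pos x h).le

lemma PosSym.gram_identity {Q : E →L[ℝ] E} (hQ : PosSym Q) (u v : E) (a b : ℝ) :
    ⟪Q (a • u + b • v), a • u + b • v⟫ =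
      a ^ 2 * ⟪Q u, u⟫ + 2 * a * b * ⟪Q u, v⟫ + b ^ 2 * ⟪Q v, v⟫ := by
  simp only [map_add, map_smul, inner_add_left, inner_add_right, inner_smul_left,
    inner_smul_right, hQ.symm' v u, conj_trivial]
  ring

lemma PosSym.cauchy {Q : E →L[ℝ] E} (hQ : PosSym Q) (u v : E) :
    ⟪Q u, v⟫ ^ 2 ≤ ⟪Q u, u⟫ * ⟪Q v, v⟫ := by
  by_cases h : v = 0
  · simp [h]
  have hv := hQ.pos v h
  have := hQ.nonneg (⟪Q v, v⟫ • u + (-⟪Q u, v⟫) • v)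
  rw [hQ.gram_identity] at this
  have h2 : 0 ≤ ⟪Q v, v⟫ * (⟪Q u, u⟫ * ⟪Q v, v⟫ - ⟪Q u, v⟫ ^ 2) := by nlinarith
  nlinarith [nonneg_of_mul_nonneg_right h2 hv]

lemma isVolForm_bot : IsVolForm (⊥ : Submodule ℝ E) (fun _ => 1) where
  cont := continuous_const
  pos := by simp
  deriv := fun Q _ x => ⟨0, by simp, by simp⟩
  greedy := fun b₀ _ => ⟨0, by simp, 1, by simp, by simp⟩

lemma isVolForm_span_singleton {u : E} (hu : u ≠ 0) :
    IsVolForm (span ℝ {u}) (fun Q => ⟪Q u, u⟫) where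
  cont := by fun_prop
  pos := fun Q hQ => hQ.pos u hu
  deriv := fun Q hQ x => by
    have h := hQ.pos u hu
    refine ⟨⟪Q x, u⟫ ^ 2 / ⟪Q u, u⟫, fun s => ?_, fun w hw => ?_⟩
    · rw [shrink_inner]; field_simp
    · obtain ⟨a, rfl⟩ := mem_span_singleton.1 hw
      simp only [map_smul, inner_smul_left, inner_smul_right, hQ.symm' u x, conj_trivial]
      apply le_of_eq; field_simp
  greedy := fun {m} b₀ hb₀ => by
    have hex : ∃ j, ⟪b₀ j, u⟫ ≠ 0 := by
      by_contra! h; exact hu (hb₀ u h)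
    obtain ⟨j, hj, hmin⟩ := WellFounded.has_min (wellFounded_lt (α := Fin m))
      {j | ⟪b₀ j, u⟫ ≠ 0} hex
    simp only [Set.mem_ofPred_eq] at hj hmin
    refine ⟨Pi.single j 1, fun i => ?_, ⟪b₀ j, u⟫ ^ 2 / 2, by positivity, ?_⟩
    · by_cases hij : i ≤ j
      · have : span ℝ {u} ⊓ tailSpace b₀ i = span ℝ {u} := by
          rw [inf_eq_left, span_singleton_le_iff_mem, mem_tailSpace]
          intro k hk
          by_contra h
          exact hmin k h (hk.trans_le hij)
        rw [this, finrank_span_singleton hu]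
        simp [hij]
      · simp [hij]
    · have hc : ContinuousAt (fun b : Fin m → E => ⟪b j, u⟫ ^ 2) b₀ := by
        apply Continuous.continuousAt; fun_prop
      have := hc.eventually (lt_mem_nhds (show ⟪b₀ j, u⟫ ^ 2 / 2 < ⟪b₀ j, u⟫ ^ 2 by
        have : 0 < ⟪b₀ j, u⟫ ^ 2 := by positivity
        linarith))
      filter_upwards [this] with b hb l Q hl hQ
      rw [hQ u u]
      have h1 : ∏ k, l k ^ (Pi.single j 1 : Fin m → ℕ) k = l j := by
        rw [Finset.prod_eq_single j] <;> simp +contextual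
      rw [h1]
      calc _ ≤ l j * (⟪b j, u⟫ * ⟪b j, u⟫) := by nlinarith [hl j]
        _ ≤ _ := Finset.single_le_sum (f := fun k => l k * (⟪b k, u⟫ * ⟪b k, u⟫))
            (fun k _ => mul_nonneg (hl k).le (mul_self_nonneg _)) (Finset.mem_univ j)

/-- The Gram determinant of `v, w` with respect to `Q`. -/
def gram (Q : E →L[ℝ] E) (v w : E) : ℝ := ⟪Q v, v⟫ * ⟪Q w, w⟫ - ⟪Q v, w⟫ ^ 2

lemma gram_diag_ge {m : ℕ} {Q : E →L[ℝ] E} {b : Fin m → E} {l : Fin m → ℝ}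
    (hQ : DiagIn Q b l) (hl : ∀ k, 0 < l k) (v w : E) {i j : Fin m} (hij : i ≠ j) :
    l i * l j * (⟪b i, v⟫ * ⟪b j, w⟫ - ⟪b j, v⟫ * ⟪b i, w⟫) ^ 2 ≤ gram Q v w := by
  set a : Fin m → ℝ := fun k => ⟪b k, v⟫
  set d : Fin m → ℝ := fun k => ⟪b k, w⟫
  have key : 2 * gram Q v w =
      ∑ p : Fin m × Fin m, l p.1 * l p.2 * (a p.1 * d p.2 - a p.2 * d p.1) ^ 2 := by
    rw [gram, hQ, hQ, hQ, sq, Finset.sum_mul_sum, Finset.sum_mul_sum, Fintype.sum_prod_type]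
    have e1 : ∀ f : Fin m → Fin m → ℝ, ∑ x, ∑ y, f x y = ∑ x, ∑ y, f y x :=
      fun f => Finset.sum_comm
    rw [two_mul]
    conv_lhs => enter [2, 1]; rw [e1]
    simp only [← Finset.sum_sub_distrib, ← Finset.sum_add_distrib]
    refine Finset.sum_congr rfl fun x _ => Finset.sum_congr rfl fun y _ => ?_
    simp only [a, d]
    ring
  have h2 : ∑ p ∈ {(i, j), (j, i)}, l p.1 * l p.2 * (a p.1 * d p.2 - a p.2 * d p.1) ^ 2 ≤
      2 * gram Q v w := by
    rw [key]
    refine Finset.sum_le_sum_of_subset_of_nonneg (Finset.subset_univ _) fun p _ _ => ?_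
    have := hl p.1; have := hl p.2; positivity
  rw [Finset.sum_pair (by simp [hij])] at h2
  simp only [a, d] at h2
  nlinarith

lemma gram_pos {v w : E} (hvw : LinearIndependent ℝ ![v, w]) {Q : E →L[ℝ] E}
    (hQ : PosSym Q) : 0 < gram Q v w := by
  have hw : w ≠ 0 := hvw.ne_zero 1
  have h1 := hQ.pos w hw
  have h2 : ⟪Q w, w⟫ • v + (-⟪Q v, w⟫) • w ≠ 0 := fun h =>
    h1.ne' (LinearIndependent.pair_iff.1 hvw _ _ h).1
  have h3 := hQ.pos _ h2
  rw [hQ.gram_identity] at h3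
  have h4 : 0 < ⟪Q w, w⟫ * gram Q v w := by unfold gram; nlinarith
  exact pos_of_mul_pos_right h4 h1.le

lemma isVolForm_span_pair {v w : E} (hvw : LinearIndependent ℝ ![v, w]) :
    IsVolForm (span ℝ {v, w}) (fun Q => gram Q v w) where
  cont := by unfold gram; fun_prop
  pos := fun Q hQ => gram_pos hvw hQ
  deriv := fun Q hQ x => by
    have hg := gram_pos hvw hQ
    refine ⟨(⟪Q x, v⟫ ^ 2 * ⟪Q w, w⟫ + ⟪Q x, w⟫ ^ 2 * ⟪Q v, v⟫ -
      2 * ⟪Q x, v⟫ * ⟪Q x, w⟫ * ⟪Q v, w⟫) / gram Q v w, fun s => ?_, fun u hu => ?_⟩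
    · have hg' := hg.ne'
      field_simp
      simp only [gram, shrink_inner]
      ring
    · obtain ⟨a, b, rfl⟩ := mem_span_pair.1 hu
      rw [hQ.gram_identity, div_mul_eq_mul_div, le_div_iff₀ hg, hQ.symm' _ x]
      simp only [inner_add_right, inner_smul_right, gram]
      nlinarith [sq_nonneg (⟪Q x, v⟫ * (a * ⟪Q v, w⟫ + b * ⟪Q w, w⟫) -
        ⟪Q x, w⟫ * (a * ⟪Q v, v⟫ + b * ⟪Q v, w⟫))]
  greedy := fun {m} b₀ hb₀ => by
    set U := span ℝ {v, w}
    have hv : v ∈ U := subset_span (by simp)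
    have hw : w ∈ U := subset_span (by simp)
    have hv0 : v ≠ 0 := hvw.ne_zero 0
    have hex : ∃ j, ∃ u ∈ U, ⟪b₀ j, u⟫ ≠ 0 := by
      by_contra! h; exact hv0 (hb₀ v fun j => h j v hv)
    obtain ⟨j₁, ⟨u, hu, hj₁⟩, hmin₁⟩ :=
      WellFounded.has_min (wellFounded_lt (α := Fin m)) {j | ∃ u ∈ U, ⟪b₀ j, u⟫ ≠ 0} hex
    simp only [Set.mem_ofPred_eq, not_lt] at hmin₁
    set u' := (-⟪b₀ j₁, w⟫) • v + ⟪b₀ j₁, v⟫ • w with hu'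
    have hu'U : u' ∈ U := add_mem (U.smul_mem _ hv) (U.smul_mem _ hw)
    have hu'j : ⟪b₀ j₁, u'⟫ = 0 := by
      simp only [hu', inner_add_right, inner_smul_right]; ring
    have hu'0 : u' ≠ 0 := by
      intro h
      obtain ⟨h1, h2⟩ := LinearIndependent.pair_iff.1 hvw _ _ h
      obtain ⟨a, b, rfl⟩ := mem_span_pair.1 hu
      apply hj₁
      simp only [inner_add_right, inner_smul_right, h2, neg_eq_zero.1 h1]; ring
    have hex2 : ∃ j, ⟪b₀ j, u'⟫ ≠ 0 := by
      by_contra! h; exact hu'0 (hb₀ u' h)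
    obtain ⟨j₂, hj₂, hmin₂⟩ :=
      WellFounded.has_min (wellFounded_lt (α := Fin m)) {j | ⟪b₀ j, u'⟫ ≠ 0} hex2
    simp only [Set.mem_ofPred_eq, not_lt] at hj₂ hmin₂
    have hj₁₂ : j₁ < j₂ := by
      refine lt_of_le_of_ne (hmin₁ j₂ ⟨u', hu'U, hj₂⟩) ?_
      rintro rfl; exact hj₂ hu'j
    have hminor : ⟪b₀ j₁, v⟫ * ⟪b₀ j₂, w⟫ - ⟪b₀ j₂, v⟫ * ⟪b₀ j₁, w⟫ ≠ 0 := by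
      intro h; apply hj₂
      simp only [hu', inner_add_right, inner_smul_right]; linarith
    set M : (Fin m → E) → ℝ := fun b => (⟪b j₁, v⟫ * ⟪b j₂, w⟫ - ⟪b j₂, v⟫ * ⟪b j₁, w⟫) ^ 2
    have hM : 0 < M b₀ := by simp only [M]; positivity
    refine ⟨Pi.single j₁ 1 + Pi.single j₂ 1, fun i => ?_, M b₀ / 2, by positivity, ?_⟩
    · have hsum : ∑ k with i ≤ k, (Pi.single j₁ 1 + Pi.single j₂ 1 : Fin m → ℕ) k =
          (if i ≤ j₁ then 1 else 0) + (if i ≤ j₂ then 1 else 0) := by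
        simp [Finset.sum_add_distrib]
      rw [hsum]
      by_cases h1 : i ≤ j₁
      · have : U ⊓ tailSpace b₀ i = U := by
          rw [inf_eq_left]
          intro y hy
          rw [mem_tailSpace]
          intro k hk
          by_contra h
          exact absurd (hmin₁ k ⟨y, hy, h⟩) (not_le.2 (hk.trans_le h1))
        have h2 : finrank ℝ U = 2 := by
          have := finrank_span_eq_card hvw
          rwa [Matrix.range_cons_cons_empty, Fintype.card_fin] at this
        rw [this, h2]
        split_ifs <;> simp
      · rw [if_neg h1]
        by_cases h2 : i ≤ j₂
        · have hmem : u' ∈ U ⊓ tailSpace b₀ i := by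
            refine ⟨hu'U, mem_tailSpace.2 fun k hk => ?_⟩
            by_contra h
            exact absurd (hmin₂ k h) (not_le.2 (hk.trans_le h2))
          have hfd : FiniteDimensional ℝ U :=
            FiniteDimensional.span_of_finite ℝ (Set.toFinite _)
          have hfd2 : FiniteDimensional ℝ ↥(U ⊓ tailSpace b₀ i) :=
            Submodule.finiteDimensional_of_le inf_le_left
          simp only [h2, if_true, zero_add]
          rw [Nat.one_le_iff_ne_zero, Ne, Submodule.finrank_eq_zero]
          intro h
          rw [h] at hmem
          exact hu'0 ((mem_bot ℝ).1 hmem)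
        · simp [h2]
    · have hc : ContinuousAt M b₀ := by
        apply Continuous.continuousAt; simp only [M]; fun_prop
      have := hc.eventually (lt_mem_nhds (show M b₀ / 2 < M b₀ by linarith))
      filter_upwards [this] with b hb l Q hl hQ
      have h1 : ∏ k, l k ^ (Pi.single j₁ 1 + Pi.single j₂ 1 : Fin m → ℕ) k = l j₁ * l j₂ := by
        simp only [Pi.add_apply, pow_add, Finset.prod_mul_distrib]
        congr 1
        · rw [Finset.prod_eq_single j₁] <;> simp +contextual
        · rw [Finset.prod_eq_single j₂] <;> simp +contextual
      rw [h1]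
      refine le_trans ?_ (gram_diag_ge hQ hl v w hj₁₂.ne)
      have := mul_pos (hl j₁) (hl j₂)
      rw [mul_comm]
      exact mul_le_mul_of_nonneg_left hb.le this.le

lemma exists_isVolForm [FiniteDimensional ℝ E] (U : Submodule ℝ E) (hU : finrank ℝ U ≤ 2) :
    ∃ F, IsVolForm U F := by
  obtain h | h | h : finrank ℝ U = 0 ∨ finrank ℝ U = 1 ∨ finrank ℝ U = 2 := by omega
  · rw [Submodule.finrank_eq_zero] at h
    exact ⟨_, h ▸ isVolForm_bot⟩
  · obtain ⟨u, hu, hspan⟩ := finrank_eq_one_iff'.1 h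
    have : U = span ℝ {(u : E)} := by
      apply le_antisymm
      · intro y hy
        obtain ⟨c, hc⟩ := hspan ⟨y, hy⟩
        exact mem_span_singleton.2 ⟨c, congrArg Subtype.val hc⟩
      · rw [span_singleton_le_iff_mem]; exact u.2
    rw [this]
    exact ⟨_, isVolForm_span_singleton (by simpa using hu)⟩
  · let b := finBasisOfFinrankEq ℝ U h
    have hli : LinearIndependent ℝ ![(b 0 : E), (b 1 : E)] := by
      have := b.linearIndependent.map' U.subtype (ker_subtype U)
      have e : ⇑U.subtype ∘ ⇑b = ![(b 0 : E), (b 1 : E)] := by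
        ext i; fin_cases i <;> rfl
      rwa [e] at this
    have : U = span ℝ {(b 0 : E), (b 1 : E)} := by
      have h1 := congrArg (Submodule.map U.subtype) b.span_eq
      rw [Submodule.map_span, Submodule.map_top, range_subtype] at h1
      refine h1.symm.trans (congrArg _ ?_)
      ext y
      simp [Set.mem_image, Fin.exists_fin_two, eq_comm]
    rw [this]
    exact ⟨_, isVolForm_span_pair hli⟩

end Scaling

section ScalingExistence

open Module Submodule
open scoped RealInnerProductSpace

lemma sum_mul_nonpos_of_tail_nonneg {m : ℕ} (c l : Fin m → ℝ) (hl : Antitone l)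
    (hl0 : ∀ i, l i ≤ 0) (hc : ∀ j, 0 ≤ ∑ k with j ≤ k, c k) : ∑ k, c k * l k ≤ 0 := by
  induction m with
  | zero => simp
  | succ m ih =>
    have h := ih (fun k => c k.succ) (fun k => l k.succ - l 0)
      (fun i j hij => sub_le_sub_right (hl (Fin.succ_le_succ_iff.2 hij)) _)
      (fun i => sub_nonpos.2 (hl (Fin.zero_le _))) (fun j => by
        have := hc j.succ
        simpa [Finset.sum_filter, Fin.sum_univ_succ] using this)
    have h0 := hc 0
    simp only [Fin.zero_le, Finset.filter_true] at h0
    have e : ∑ k, c k * l k =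
        (∑ k, c k) * l 0 + ∑ k : Fin m, c k.succ * (l k.succ - l 0) := by
      rw [Fin.sum_univ_succ, Fin.sum_univ_succ, add_mul, Finset.sum_mul, add_assoc,
        ← Finset.sum_add_distrib]
      congr 1
      exact Finset.sum_congr rfl fun k _ => by ring
    rw [e]
    nlinarith [mul_nonpos_of_nonneg_of_nonpos h0 (hl0 0)]

variable {E : Type*} [NormedAddCommGroup E] [InnerProductSpace ℝ E]

lemma PosSym.shrink {Q : E →L[ℝ] E} (hQ : PosSym Q) (x : E) {s : ℝ} (hs : 0 ≤ s)
    (h : s * ⟪Q x, x⟫ < 1) : PosSym (shrink Q x s) where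
  symm := fun u v => by
    rw [real_inner_comm _ u, shrink_inner, shrink_inner, hQ.symm' u v]; ring
  pos := fun u hu => by
    rw [shrink_inner]
    have h1 := hQ.cauchy x u
    have h2 := hQ.pos u hu
    nlinarith [mul_le_mul_of_nonneg_left h1 hs, mul_pos h2 (sub_pos.2 h)]

variable [FiniteDimensional ℝ E]

lemma det_shrink (Q : E →L[ℝ] E) (x : E) (s : ℝ) :
    (shrink Q x s).det = Q.det * (1 - s * ⟪Q x, x⟫) := by
  have e : ((shrink Q x s : E →L[ℝ] E) : E →ₗ[ℝ] E) =
      (Q : E →ₗ[ℝ] E) ∘ₗ LinearMap.transvection (innerₛₗ ℝ (Q x)) (-s • x) := by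
    ext u
    simp [shrink, LinearMap.transvection.apply, smul_smul, mul_comm, sub_eq_add_neg]
  rw [ContinuousLinearMap.det, e, LinearMap.det_comp, LinearMap.transvection.det]
  simp [ContinuousLinearMap.det, sub_eq_add_neg, inner_smul_right]

lemma PosSym.exists_diag {Q : E →L[ℝ] E} (hQ : PosSym Q) :
    ∃ (b : Fin (finrank ℝ E) → E) (l : Fin (finrank ℝ E) → ℝ), Orthonormal ℝ b ∧ Antitone l ∧
      (∀ k, 0 < l k) ∧ DiagIn Q b l ∧ Q.det = ∏ k, l k := by
  have hs : (Q : E →ₗ[ℝ] E).IsSymmetric := hQ.symm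
  set b := hs.eigenvectorBasis rfl
  have hb : ∀ k, Q (b k) = hs.eigenvalues rfl k • b k := fun k => hs.apply_eigenvectorBasis rfl k
  refine ⟨b, hs.eigenvalues rfl, b.orthonormal, hs.eigenvalues_antitone rfl, fun k => ?_,
    fun u v => ?_, ?_⟩
  · have := hQ.pos (b k) (b.orthonormal.ne_zero k)
    rw [hb, inner_smul_left] at this
    simpa using this
  · rw [← b.sum_inner_mul_inner]
    refine Finset.sum_congr rfl fun k _ => ?_
    rw [hQ.symm, hb, inner_smul_right, real_inner_comm (b k) u]
    ring
  · exact hs.det_eq_prod_eigenvalues rfl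

lemma Orthonormal.eq_zero_of_inner {m : ℕ} {b : Fin m → E} (hb : Orthonormal ℝ b)
    (hm : m = finrank ℝ E) {x : E} (hx : ∀ k, ⟪b k, x⟫ = 0) : x = 0 := by
  have hsp := hb.linearIndependent.span_eq_top_of_card_eq_finrank' (by simpa using hm)
  let B := OrthonormalBasis.mk hb hsp.ge
  have hB : ∀ i, B i = b i := fun i => by simp [B]
  rw [← B.sum_repr' x]
  exact Finset.sum_eq_zero fun i _ => by rw [hB, hx, zero_smul]

lemma finrank_tailSpace_le {m : ℕ} {b : Fin m → E} (hb : Orthonormal ℝ b)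
    (hm : m = finrank ℝ E) (j : Fin m) :
    finrank ℝ (tailSpace b j) ≤ (Finset.univ.filter fun k => j ≤ k).card := by
  let f : tailSpace b j →ₗ[ℝ] ({k // j ≤ k} → ℝ) :=
    (LinearMap.pi fun k : {k // j ≤ k} => (innerₛₗ ℝ (b k))) ∘ₗ (tailSpace b j).subtype
  have hf : Function.Injective f := by
    rw [injective_iff_map_eq_zero]
    intro x hx
    apply Subtype.ext
    refine hb.eq_zero_of_inner hm fun k => ?_
    by_cases h : j ≤ k
    · exact congrFun hx ⟨k, h⟩
    · exact mem_tailSpace.1 x.2 k (not_le.1 h)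
  have := LinearMap.finrank_le_finrank_of_injective hf
  simpa [Fintype.card_subtype] using this

variable {P : Type*} [Fintype P]

/-- The functional maximised to find the scaling. -/
def scalingFun (F : P → (E →L[ℝ] E) → ℝ) (K : ℝ) (Q : E →L[ℝ] E) : ℝ :=
  K * Real.log Q.det - ∑ p, Real.log (F p Q)

lemma tail_sum_pos {U : P → Submodule ℝ E} {K : ℝ}
    (hK : ∀ H : Submodule ℝ E, H ≠ ⊥ → ∑ p, (finrank ℝ ↥(U p ⊓ H) : ℝ) < K * finrank ℝ H)
    {m : ℕ} (hm : m = finrank ℝ E) {b₀ : Fin m → E} (hb₀ : Orthonormal ℝ b₀) {N : P → Fin m → ℕ}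
    (hN : ∀ p j, ∑ k with j ≤ k, N p k ≤ finrank ℝ ↥(U p ⊓ tailSpace b₀ j)) (j : Fin m) :
    0 < ∑ k with j ≤ k, (K - ∑ p, (N p k : ℝ)) := by
  have hne : tailSpace b₀ j ≠ ⊥ := by
    intro h
    have : b₀ j ∈ tailSpace b₀ j := mem_tailSpace.2 fun k hk => hb₀.inner_eq_zero hk.ne
    rw [h, mem_bot] at this
    exact hb₀.ne_zero j this
  have h1 := hK _ hne
  have h2 := finrank_tailSpace_le hb₀ hm j
  have h3 : ∑ p, ∑ k with j ≤ k, (N p k : ℝ) ≤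
      ∑ p, (finrank ℝ ↥(U p ⊓ tailSpace b₀ j) : ℝ) :=
    Finset.sum_le_sum fun p _ => by exact_mod_cast hN p j
  have h0 : (0 : ℝ) ≤ ∑ p, (finrank ℝ ↥(U p ⊓ tailSpace b₀ j) : ℝ) :=
    Finset.sum_nonneg fun p _ => Nat.cast_nonneg _
  have hpos : 0 < finrank ℝ (tailSpace b₀ j) := Submodule.one_le_finrank_iff.2 hne
  rw [Finset.sum_sub_distrib, Finset.sum_const, nsmul_eq_mul, Finset.sum_comm]
  generalize finrank ℝ (tailSpace b₀ j) = d at *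
  have hpos' : (0 : ℝ) < d := by exact_mod_cast hpos
  have h2' : (d : ℝ) ≤ (Finset.univ.filter fun k => j ≤ k).card := by exact_mod_cast h2
  have hK0 : 0 < K := pos_of_mul_pos_left (h0.trans_lt h1) hpos'.le
  nlinarith

lemma scalingFun_local_bound {U : P → Submodule ℝ E} {F : P → (E →L[ℝ] E) → ℝ}
    (hF : ∀ p, IsVolForm (U p) (F p)) {K : ℝ}
    (hK : ∀ H : Submodule ℝ E, H ≠ ⊥ → ∑ p, (finrank ℝ ↥(U p ⊓ H) : ℝ) < K * finrank ℝ H)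
    {m : ℕ} (hm : m = finrank ℝ E) {b₀ : Fin m → E} (hb₀ : Orthonormal ℝ b₀) :
    ∃ t ∈ nhds b₀, ∃ C τ : ℝ, 0 < τ ∧ ∀ b ∈ t, ∀ (l : Fin m → ℝ) (Q : E →L[ℝ] E), Antitone l →
      (∀ k, 0 < l k) → (∀ k, l k ≤ 1) → DiagIn Q b l → Q.det = ∏ k, l k →
      ∀ j, scalingFun F K Q ≤ τ * Real.log (l j) + C := by
  choose N hN c hc hev using fun p => (hF p).greedy b₀ fun x => hb₀.eq_zero_of_inner hm
  set w : Fin m → ℝ := fun k => K - ∑ p, (N p k : ℝ)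
  have htail : ∀ j, 0 < ∑ k with j ≤ k, w k := tail_sum_pos hK hm hb₀ hN
  obtain ⟨τ, hτ, hτt⟩ : ∃ τ > 0, ∀ j, τ ≤ ∑ k with j ≤ k, w k := by
    rcases isEmpty_or_nonempty (Fin m) with h | h
    · exact ⟨1, one_pos, fun j => h.elim j⟩
    · obtain ⟨j, hj⟩ := Finite.exists_min fun j => ∑ k with j ≤ k, w k
      exact ⟨_, htail j, hj⟩
  refine ⟨_, Filter.eventually_all.2 hev, -∑ p, Real.log (c p), τ, hτ, ?_⟩
  intro b hb l Q hanti hl hl1 hdiag hdet j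
  have hlog : ∀ p, Real.log (c p) + ∑ k, N p k * Real.log (l k) ≤ Real.log (F p Q) := fun p => by
    have h1 := hb p l Q hl hdiag
    have hprod : 0 < ∏ k, l k ^ N p k := Finset.prod_pos fun k _ => pow_pos (hl k) _
    have h2 := Real.log_le_log (mul_pos (hc p) hprod) h1
    rw [Real.log_mul (hc p).ne' hprod.ne', Real.log_prod fun k _ => (pow_pos (hl k) _).ne'] at h2
    simpa [Real.log_pow] using h2
  have hlogl : ∀ k, Real.log (l k) ≤ 0 := fun k => Real.log_nonpos (hl k).le (hl1 k)
  have habel := sum_mul_nonpos_of_tail_nonneg (fun k => w k - if k = j then τ else 0)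
    (fun k => Real.log (l k)) (fun a b hab => Real.log_le_log (hl b) (hanti hab)) hlogl
    (fun i => by
      rw [Finset.sum_sub_distrib, Finset.sum_ite_eq']
      have := hτt i
      split_ifs <;> linarith)
  have e1 : ∑ k, (w k - if k = j then τ else 0) * Real.log (l k) =
      (K * ∑ k, Real.log (l k) - ∑ p, ∑ k, N p k * Real.log (l k)) - τ * Real.log (l j) := by
    simp only [sub_mul, Finset.sum_sub_distrib, w, ite_mul, zero_mul, Finset.sum_ite_eq',
      Finset.mem_univ, if_true, Finset.mul_sum, Finset.sum_mul]
    rw [Finset.sum_comm]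
  rw [e1] at habel
  rw [scalingFun, hdet, Real.log_prod fun k _ => (hl k).ne']
  have h5 := Finset.sum_le_sum fun p (_ : p ∈ Finset.univ) => hlog p
  rw [Finset.sum_add_distrib] at h5
  linarith

lemma isCompact_orthonormal (m : ℕ) : IsCompact {b : Fin m → E | Orthonormal ℝ b} := by
  have : ProperSpace E := FiniteDimensional.proper ℝ E
  refine (isCompact_univ_pi fun _ : Fin m => isCompact_closedBall (0 : E) 1).of_isClosed_subset
    ?_ fun b hb k _ => by simp [hb.1 k]
  simp only [orthonormal_iff_ite, Set.ofPred_forall]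
  exact isClosed_iInter fun i => isClosed_iInter fun j =>
    isClosed_eq (by fun_prop) continuous_const

lemma scalingFun_bound {U : P → Submodule ℝ E} {F : P → (E →L[ℝ] E) → ℝ}
    (hF : ∀ p, IsVolForm (U p) (F p)) {K : ℝ}
    (hK : ∀ H : Submodule ℝ E, H ≠ ⊥ → ∑ p, (finrank ℝ ↥(U p ⊓ H) : ℝ) < K * finrank ℝ H) :
    ∃ C τ : ℝ, 0 < τ ∧ ∀ b : Fin (finrank ℝ E) → E, Orthonormal ℝ b →
      ∀ (l : Fin (finrank ℝ E) → ℝ) (Q : E →L[ℝ] E), Antitone l →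
      (∀ k, 0 < l k) → (∀ k, l k ≤ 1) → DiagIn Q b l → Q.det = ∏ k, l k →
      ∀ j, scalingFun F K Q ≤ τ * Real.log (l j) + C := by
  refine (isCompact_orthonormal (E := E) (finrank ℝ E)).induction_on
    (p := fun S => ∃ C τ : ℝ, 0 < τ ∧ ∀ b ∈ S, ∀ (l : Fin (finrank ℝ E) → ℝ) (Q : E →L[ℝ] E),
      Antitone l → (∀ k, 0 < l k) → (∀ k, l k ≤ 1) → DiagIn Q b l → Q.det = ∏ k, l k →
      ∀ j, scalingFun F K Q ≤ τ * Real.log (l j) + C) ?_ ?_ ?_ ?_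
  · exact ⟨0, 1, one_pos, by simp⟩
  · rintro s t hst ⟨C, τ, hτ, h⟩
    exact ⟨C, τ, hτ, fun b hb => h b (hst hb)⟩
  · rintro s t ⟨C, τ, hτ, h⟩ ⟨C', τ', hτ', h'⟩
    refine ⟨max C C', min τ τ', lt_min hτ hτ', ?_⟩
    intro b hb l Q hanti hl hl1 hd hdet j
    have hlog := Real.log_nonpos (hl j).le (hl1 j)
    rcases hb with hb | hb
    · have := h b hb l Q hanti hl hl1 hd hdet j
      nlinarith [le_max_left C C', mul_le_mul_of_nonpos_right (min_le_left τ τ') hlog]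
    · have := h' b hb l Q hanti hl hl1 hd hdet j
      nlinarith [le_max_right C C', mul_le_mul_of_nonpos_right (min_le_right τ τ') hlog]
  · intro b hb
    obtain ⟨t, ht, h⟩ := scalingFun_local_bound hF hK rfl hb
    exact ⟨t, mem_nhdsWithin_of_mem_nhds ht, h⟩

lemma PosSym.det_pos {Q : E →L[ℝ] E} (hQ : PosSym Q) : 0 < Q.det := by
  obtain ⟨b, l, -, -, hl, -, h⟩ := hQ.exists_diag
  rw [h]
  exact Finset.prod_pos fun k _ => hl k

lemma exists_coercive {U : P → Submodule ℝ E} {F : P → (E →L[ℝ] E) → ℝ}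
    (hF : ∀ p, IsVolForm (U p) (F p)) {K : ℝ}
    (hK : ∀ H : Submodule ℝ E, H ≠ ⊥ → ∑ p, (finrank ℝ ↥(U p ⊓ H) : ℝ) < K * finrank ℝ H)
    (A : ℝ) : ∃ δ > 0, ∀ Q : E →L[ℝ] E, PosSym Q → (∀ x, ⟪Q x, x⟫ ≤ ⟪x, x⟫) →
      A ≤ scalingFun F K Q → ∀ x, δ * ⟪x, x⟫ ≤ ⟪Q x, x⟫ := by
  obtain ⟨C, τ, hτ, h⟩ := scalingFun_bound hF hK
  refine ⟨Real.exp ((A - C) / τ), Real.exp_pos _, fun Q hQ hQ1 hA x => ?_⟩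
  obtain ⟨b, l, hb, hanti, hl, hd, hdet⟩ := hQ.exists_diag
  have hbb : ∀ j k, ⟪b k, b j⟫ = if k = j then 1 else 0 := fun j k =>
    orthonormal_iff_ite.1 hb k j
  have hl1 : ∀ k, l k ≤ 1 := fun j => by
    have := hQ1 (b j)
    rw [hd] at this
    simpa [hbb, hb.1 j] using this
  have hδ : ∀ j, Real.exp ((A - C) / τ) ≤ l j := fun j => by
    rw [← Real.le_log_iff_exp_le (hl j), div_le_iff₀ hτ]
    linarith [h b hb l Q hanti hl hl1 hd hdet j]
  have hsp := hb.linearIndependent.span_eq_top_of_card_eq_finrank' (by simp)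
  have hx := (OrthonormalBasis.mk hb hsp.ge).sum_inner_mul_inner x x
  simp only [OrthonormalBasis.coe_mk] at hx
  rw [hd, ← hx, Finset.mul_sum]
  refine Finset.sum_le_sum fun k _ => ?_
  rw [real_inner_comm (b k) x]
  exact mul_le_mul_of_nonneg_right (hδ k) (mul_self_nonneg _)

end ScalingExistence

section ScalingTheorem

open Module Submodule
open scoped RealInnerProductSpace

variable {E : Type*} [NormedAddCommGroup E] [InnerProductSpace ℝ E]

lemma PosSym.norm_apply_le {Q : E →L[ℝ] E} (hQ : PosSym Q) (h1 : ∀ x, ⟪Q x, x⟫ ≤ ⟪x, x⟫)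
    (x : E) : ‖Q x‖ ≤ ‖x‖ := by
  have h := hQ.cauchy x (Q x)
  have h2 := h1 x
  have h3 := h1 (Q x)
  have h4 := hQ.nonneg x
  have h5 := hQ.nonneg (Q x)
  rw [real_inner_self_eq_norm_sq] at *
  by_contra! hlt
  have hx := norm_nonneg x
  have : ⟪Q x, x⟫ * ⟪Q (Q x), Q x⟫ ≤ ‖x‖ ^ 2 * ‖Q x‖ ^ 2 := by gcongr
  have h6 : 0 < ‖Q x‖ ^ 2 := pow_pos (hx.trans_lt hlt) 2
  have h7 : ‖x‖ ^ 2 < ‖Q x‖ ^ 2 := by gcongr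
  nlinarith

variable [FiniteDimensional ℝ E] {P : Type*} [Fintype P]

lemma exists_isMax_scalingFun {F : P → (E →L[ℝ] E) → ℝ} {U : P → Submodule ℝ E}
    (hF : ∀ p, IsVolForm (U p) (F p)) {K : ℝ}
    (hK : ∀ H : Submodule ℝ E, H ≠ ⊥ → ∑ p, (finrank ℝ ↥(U p ⊓ H) : ℝ) < K * finrank ℝ H) :
    ∃ Q : E →L[ℝ] E, PosSym Q ∧ (∀ x, ⟪Q x, x⟫ ≤ ⟪x, x⟫) ∧ ∀ Q' : E →L[ℝ] E, PosSym Q' →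
      (∀ x, ⟪Q' x, x⟫ ≤ ⟪x, x⟫) → scalingFun F K Q' ≤ scalingFun F K Q := by
  obtain ⟨δ, hδ, h⟩ := exists_coercive hF hK (scalingFun F K (ContinuousLinearMap.id ℝ E))
  have : ProperSpace (E →L[ℝ] E) := FiniteDimensional.proper ℝ _
  let S : Set (E →L[ℝ] E) := {Q | (∀ x y, ⟪Q x, y⟫ = ⟪x, Q y⟫) ∧
    (∀ x, min δ 1 * ⟪x, x⟫ ≤ ⟪Q x, x⟫) ∧ ∀ x, ⟪Q x, x⟫ ≤ ⟪x, x⟫}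
  have hpos : ∀ Q ∈ S, PosSym Q := fun Q hQ => ⟨hQ.1, fun x hx =>
    (mul_pos (lt_min hδ one_pos) (real_inner_self_pos.2 hx)).trans_le (hQ.2.1 x)⟩
  have hclosed : IsClosed S := by
    simp only [S, Set.ofPred_and, Set.ofPred_forall]
    refine (isClosed_iInter fun x => isClosed_iInter fun y => isClosed_eq ?_ ?_).inter
      ((isClosed_iInter fun x => isClosed_le ?_ ?_).inter
        (isClosed_iInter fun x => isClosed_le ?_ ?_)) <;> fun_prop
  have hbdd : Bornology.IsBounded S :=
    (Metric.isBounded_closedBall (x := 0) (r := 1)).subset fun Q hQ => by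
      rw [mem_closedBall_zero_iff]
      exact Q.opNorm_le_bound zero_le_one fun x => by
        rw [one_mul]; exact (hpos Q hQ).norm_apply_le hQ.2.2 x
  have hid : ContinuousLinearMap.id ℝ E ∈ S := by
    refine ⟨fun _ _ => rfl, fun x => ?_, fun _ => le_rfl⟩
    simpa using mul_le_of_le_one_left (real_inner_self_nonneg (x := x)) (min_le_right δ 1)
  have hcont : ContinuousOn (scalingFun F K) S := by
    unfold scalingFun
    refine ContinuousOn.sub (continuousOn_const.mul (ContinuousOn.log ?_ fun Q hQ =>
      (hpos Q hQ).det_pos.ne')) (continuousOn_finsetSum _ fun p _ =>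
        (hF p).cont.continuousOn.log fun Q hQ => ((hF p).pos Q (hpos Q hQ)).ne')
    exact ContinuousLinearMap.continuous_det.continuousOn
  obtain ⟨Q, hQ, hmax⟩ := (Metric.isCompact_of_isClosed_isBounded hclosed hbdd).exists_isMaxOn
    ⟨_, hid⟩ hcont
  refine ⟨Q, hpos Q hQ, hQ.2.2, fun Q' hQ' h1 => ?_⟩
  rcases le_total (scalingFun F K (ContinuousLinearMap.id ℝ E)) (scalingFun F K Q') with h2 | h2
  · refine hmax ⟨hQ'.symm, fun x => ?_, h1⟩
    exact (mul_le_mul_of_nonneg_right (min_le_left δ 1) real_inner_self_nonneg).trans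
      (h Q' hQ' h1 h2 x)
  · exact h2.trans (hmax hid)

lemma sum_le_of_log_nonpos (π : P → ℝ) (K c : ℝ)
    (h : ∀ᶠ s in nhdsWithin (0 : ℝ) (Set.Ioi 0),
      K * Real.log (1 - s * c) - ∑ p, Real.log (1 - s * π p) ≤ 0) : ∑ p, π p ≤ K * c := by
  have hl : ∀ a : ℝ, HasDerivAt (fun s : ℝ => Real.log (1 - s * a)) (-a) 0 := fun a => by
    have := (((hasDerivAt_id (0 : ℝ)).mul_const a).const_sub 1).log (by simp)
    simpa using this
  have hd : HasDerivAt (fun s : ℝ => K * Real.log (1 - s * c) - ∑ p, Real.log (1 - s * π p))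
      (K * -c - ∑ p, -π p) 0 :=
    ((hl c).const_mul K).sub (HasDerivAt.fun_sum fun p _ => hl (π p))
  have ht := hd.tendsto_slope_zero_right
  have : K * -c - ∑ p, -π p ≤ 0 := by
    refine le_of_tendsto ht ?_
    filter_upwards [h, self_mem_nhdsWithin] with s hs hs0
    simp only [zero_add, zero_mul, sub_zero, Real.log_one, mul_zero, Finset.sum_const_zero,
      smul_eq_mul]
    exact mul_nonpos_of_nonneg_of_nonpos (inv_nonneg.2 (le_of_lt hs0)) hs
  rw [Finset.sum_neg_distrib] at this
  linarith

/-- A scaling theorem for a family of subspaces of dimension at most two. -/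
theorem exists_scaling {U : P → Submodule ℝ E} (hU : ∀ p, finrank ℝ (U p) ≤ 2) {K : ℝ}
    (hK : ∀ H : Submodule ℝ E, H ≠ ⊥ → ∑ p, (finrank ℝ ↥(U p ⊓ H) : ℝ) < K * finrank ℝ H) :
    ∃ Q : E →L[ℝ] E, PosSym Q ∧ ∀ x, ∃ π : P → ℝ, (∀ p, 0 ≤ π p) ∧
      (∀ p, ∀ u ∈ U p, ⟪Q u, x⟫ ^ 2 ≤ π p * ⟪Q u, u⟫) ∧ ∑ p, π p ≤ K * ⟪Q x, x⟫ := by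
  have hex : ∀ p, ∃ F, IsVolForm (U p) F ∧ (U p = ⊥ → F = fun _ => 1) := fun p => by
    by_cases h : U p = ⊥
    · exact ⟨fun _ => 1, h ▸ isVolForm_bot, fun _ => rfl⟩
    · obtain ⟨F, hF⟩ := exists_isVolForm (U p) (hU p)
      exact ⟨F, hF, fun h' => absurd h' h⟩
  choose F hF hF1 using hex
  obtain ⟨Q, hQ, hQ1, hmax⟩ := exists_isMax_scalingFun hF hK
  refine ⟨Q, hQ, fun x => ?_⟩
  choose π hπ hπu using fun p => (hF p).deriv Q hQ x
  have hπ0 : ∀ p, 0 ≤ π p := fun p => by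
    by_cases h : U p = ⊥
    · have := hπ p 1
      rw [hF1 p h] at this
      linarith
    · obtain ⟨u, hu, hu0⟩ := (Submodule.ne_bot_iff _).1 h
      exact nonneg_of_mul_nonneg_left ((sq_nonneg _).trans (hπu p u hu)) (hQ.pos u hu0)
  refine ⟨π, hπ0, hπu, sum_le_of_log_nonpos π K _ ?_⟩
  have hev : ∀ᶠ s in nhdsWithin (0 : ℝ) (Set.Ioi 0), s * ⟪Q x, x⟫ < 1 := by
    have : ContinuousAt (fun s : ℝ => s * ⟪Q x, x⟫) 0 := by fun_prop
    exact nhdsWithin_le_nhds (this.eventually (gt_mem_nhds (by simp)))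
  filter_upwards [hev, self_mem_nhdsWithin] with s hs hs0
  have hs0' : 0 ≤ s := le_of_lt hs0
  have hQ' := hQ.shrink x hs0' hs
  have h := hmax _ hQ' fun y => by
    rw [shrink_inner]
    nlinarith [hQ1 y, mul_nonneg hs0' (mul_self_nonneg ⟪Q x, y⟫)]
  have hp : ∀ p, Real.log (F p (shrink Q x s)) = Real.log (F p Q) + Real.log (1 - s * π p) :=
    fun p => by
      have h1 := (hF p).pos Q hQ
      have h2 := (hF p).pos _ hQ'
      rw [hπ] at h2 ⊢
      exact Real.log_mul h1.ne' (pos_of_mul_pos_right h2 h1.le).ne'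
  rw [scalingFun, scalingFun, det_shrink, Real.log_mul hQ.det_pos.ne' (by linarith)] at h
  simp only [hp, Finset.sum_add_distrib] at h
  linarith

end ScalingTheorem

section Counting

open Module Submodule
open scoped RealInnerProductSpace

variable {E : Type*} [NormedAddCommGroup E] [InnerProductSpace ℝ E]
  {P : Type*} [Fintype P]

lemma PosSym.exists_correlated_pair {Q : E →L[ℝ] E} (hQ : PosSym Q) {v : Fin 3 → E}
    (hv : ∑ k, v k = 0) (hne : ∃ k, v k ≠ 0) :
    ∃ k l, k ≠ l ∧ v k ≠ 0 ∧ v l ≠ 0 ∧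
      ⟪Q (v k), v k⟫ * ⟪Q (v l), v l⟫ ≤ 4 * ⟪Q (v k), v l⟫ ^ 2 := by
  obtain ⟨k, hk⟩ := Finite.exists_max fun k => ⟪Q (v k), v k⟫
  have hk0 : v k ≠ 0 := by
    obtain ⟨j, hj⟩ := hne
    intro h
    have := hk j
    rw [h] at this
    simp only [map_zero, inner_zero_right] at this
    exact absurd this (not_le.2 (hQ.pos _ hj))
  have hpos := hQ.pos _ hk0
  have hsum : ∑ l, ⟪Q (v k), v l⟫ = 0 := by rw [← inner_sum, hv, inner_zero_right]
  obtain ⟨l, hlk, hl⟩ : ∃ l, k ≠ l ∧ ⟪Q (v k), v k⟫ ≤ -2 * ⟪Q (v k), v l⟫ := by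
    by_contra! hcon
    rw [Fin.sum_univ_three] at hsum
    fin_cases k
    · have h1 := hcon 1 (by decide)
      have h2 := hcon 2 (by decide)
      simp only [Fin.zero_eta] at *
      linarith
    · have h1 := hcon 0 (by decide)
      have h2 := hcon 2 (by decide)
      simp only [Fin.mk_one] at *
      linarith
    · have h1 := hcon 0 (by decide)
      have h2 := hcon 1 (by decide)
      simp only [Fin.reduceFinMk] at *
      linarith
  refine ⟨k, l, hlk, hk0, fun h => ?_, ?_⟩
  · rw [h, inner_zero_right] at hl
    linarith
  · nlinarith [hk l, hQ.nonneg (v l)]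

variable [FiniteDimensional ℝ E]

lemma PosSym.exists_orthogonal_frame {Q : E →L[ℝ] E} (hQ : PosSym Q) (U : Submodule ℝ E) :
    ∃ e : Fin (finrank ℝ U) → E, (∀ k, e k ≠ 0) ∧ ∀ v ∈ U, ∃ c : Fin (finrank ℝ U) → ℝ,
      v = ∑ k, c k • e k ∧ ⟪Q v, v⟫ = ∑ k, c k ^ 2 * ⟪Q (e k), e k⟫ := by
  let B : LinearMap.BilinForm ℝ U :=
    ((innerₛₗ ℝ (E := E)) ∘ₗ (Q : E →ₗ[ℝ] E)).compl₁₂ U.subtype U.subtype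
  have hB : ∀ x y : U, B x y = ⟪Q x, y⟫ := fun _ _ => rfl
  have hsymm : LinearMap.IsSymm B := ⟨fun x y => by simp [hB, hQ.symm' x y]⟩
  obtain ⟨e, he⟩ := LinearMap.BilinForm.exists_orthogonal_basis hsymm
  refine ⟨fun k => e k, fun k => by simpa using e.ne_zero k, fun v hv => ?_⟩
  refine ⟨fun k => e.repr ⟨v, hv⟩ k, ?_, ?_⟩
  · calc v = ((∑ k, e.repr ⟨v, hv⟩ k • e k : U) : E) := by rw [e.sum_repr]
      _ = _ := by simp only [Submodule.coe_sum, Submodule.coe_smul]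
  · have h1 : B ⟨v, hv⟩ ⟨v, hv⟩ = ⟪Q v, v⟫ := rfl
    have he' : ∀ i j, i ≠ j → B (e i) (e j) = 0 := fun i j hij => he hij
    rw [← h1]
    conv_lhs => rw [← e.sum_repr ⟨v, hv⟩]
    simp only [map_sum, LinearMap.sum_apply, map_smul, LinearMap.smul_apply, smul_eq_mul]
    refine Finset.sum_congr rfl fun k _ => ?_
    rw [Finset.sum_eq_single k (fun i _ hi => by rw [he' _ _ hi]; ring) (by simp), hB]
    ring

lemma exists_pair_weights {U : P → Submodule ℝ E} (hU : ∀ p, finrank ℝ (U p) ≤ 2) {K : ℝ}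
    (hK : ∀ H : Submodule ℝ E, H ≠ ⊥ → ∑ p, (finrank ℝ ↥(U p ⊓ H) : ℝ) < K * finrank ℝ H) :
    ∃ (Q : E →L[ℝ] E) (M : P → P → ℝ), PosSym Q ∧ (∀ p q, 0 ≤ M p q) ∧
      (∀ p q, ∀ u ∈ U p, ∀ v ∈ U q, ⟪Q u, v⟫ ^ 2 ≤ M p q * (⟪Q u, u⟫ * ⟪Q v, v⟫)) ∧
      ∀ q, ∑ p, M p q ≤ K * finrank ℝ (U q) := by
  obtain ⟨Q, hQ, hπ⟩ := exists_scaling hU hK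
  choose π hπ0 hπ1 hπ2 using hπ
  choose e he0 he using fun q => hQ.exists_orthogonal_frame (U q)
  have hd : ∀ q k, 0 < ⟪Q (e q k), e q k⟫ := fun q k => hQ.pos _ (he0 q k)
  refine ⟨Q, fun p q => ∑ k, π (e q k) p / ⟪Q (e q k), e q k⟫, hQ, fun p q =>
    Finset.sum_nonneg fun k _ => div_nonneg (hπ0 _ _) (hd q k).le, ?_, fun q => ?_⟩
  · intro p q u hu v hv
    obtain ⟨c, hc, hcc⟩ := he q v hv
    have h : ⟪Q u, v⟫ = ∑ k, c k * ⟪Q u, e q k⟫ := by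
      rw [hc, inner_sum]
      exact Finset.sum_congr rfl fun k _ => inner_smul_right _ _ _
    have h2 := Finset.sum_sq_le_sum_mul_sum_of_sq_le_mul Finset.univ
      (r := fun k => c k * ⟪Q u, e q k⟫) (f := fun k => c k ^ 2 * ⟪Q (e q k), e q k⟫)
      (g := fun k => π (e q k) p / ⟪Q (e q k), e q k⟫ * ⟪Q u, u⟫)
      (fun k _ => mul_nonneg (sq_nonneg _) (hd q k).le)
      (fun k _ => mul_nonneg (div_nonneg (hπ0 _ _) (hd q k).le) (hQ.nonneg u))
      (fun k _ => by
        have h3 := hπ1 (e q k) p u hu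
        have h4 := (hd q k).ne'
        have h5 : c k ^ 2 * ⟪Q (e q k), e q k⟫ * (π (e q k) p / ⟪Q (e q k), e q k⟫ * ⟪Q u, u⟫) =
          c k ^ 2 * (π (e q k) p * ⟪Q u, u⟫) := by field_simp
        rw [h5, mul_pow]
        exact mul_le_mul_of_nonneg_left h3 (sq_nonneg _))
    rw [h, hcc]
    refine h2.trans_eq ?_
    rw [← Finset.sum_mul]
    ring
  · rw [Finset.sum_comm]
    have : ∀ k, ∑ p, π (e q k) p / ⟪Q (e q k), e q k⟫ ≤ K := fun k => by
      rw [← Finset.sum_div, div_le_iff₀ (hd q k)]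
      exact hπ2 _
    refine (Finset.sum_le_sum fun k _ => this k).trans_eq ?_
    simp [mul_comm]

open Classical in
/-- The number of nontrivial vanishing triples drawn from a family of subspaces in general
position is linear in the number of nonzero subspaces. -/
theorem card_good_triples_le {U : P → Submodule ℝ E} (hU : ∀ p, finrank ℝ (U p) ≤ 2) {K : ℝ}
    (hK0 : 0 ≤ K)
    (hK : ∀ H : Submodule ℝ E, H ≠ ⊥ → ∑ p, (finrank ℝ ↥(U p ⊓ H) : ℝ) < K * finrank ℝ H)
    {ι : Type*} [Fintype ι] (tri : ι → Fin 3 → P) (v : ι → Fin 3 → E)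
    (hv : ∀ i k, v i k ∈ U (tri i k)) (hsum : ∀ i, ∑ k, v i k = 0)
    (hmult : ∀ p q, (Finset.univ.filter fun i =>
      ∃ k l, k ≠ l ∧ tri i k = p ∧ tri i l = q).card ≤ 3) :
    ((Finset.univ.filter fun i => ∃ k, v i k ≠ 0).card : ℝ) ≤
      24 * K * (Finset.univ.filter fun p => U p ≠ ⊥).card := by
  obtain ⟨Q, M, hQ, hM0, hM1, hM2⟩ := exists_pair_weights hU hK
  set G := Finset.univ.filter fun i => ∃ k, v i k ≠ 0
  have hpair : ∀ i, ∃ pq : P × P, i ∈ G →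
      (∃ k l, k ≠ l ∧ tri i k = pq.1 ∧ tri i l = pq.2) ∧ 1 ≤ 4 * M pq.1 pq.2 := fun i => by
    by_cases hi : i ∈ G
    · obtain ⟨k, l, hkl, hk, hl, h⟩ :=
        hQ.exists_correlated_pair (hsum i) (by simpa [G] using hi)
      refine ⟨(tri i k, tri i l), fun _ => ⟨⟨k, l, hkl, rfl, rfl⟩, ?_⟩⟩
      have h1 := hM1 _ _ _ (hv i k) _ (hv i l)
      have h2 := mul_pos (hQ.pos _ hk) (hQ.pos _ hl)
      simp only
      by_contra! h3
      nlinarith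
    · exact ⟨(tri i 0, tri i 0), fun h => absurd h hi⟩
  choose f hf using hpair
  have h1 : (G.card : ℝ) ≤ ∑ i ∈ G, 4 * M (f i).1 (f i).2 := by
    rw [← nsmul_one, ← Finset.sum_const]
    exact Finset.sum_le_sum fun i hi => (hf i hi).2
  have h2 : ∑ i ∈ G, 4 * M (f i).1 (f i).2 ≤ ∑ pq : P × P, 3 * (4 * M pq.1 pq.2) := by
    rw [← Finset.sum_fiberwise_of_maps_to (g := f) (t := Finset.univ) fun _ _ => Finset.mem_univ _]
    refine Finset.sum_le_sum fun pq _ => ?_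
    rw [Finset.sum_congr rfl fun i hi => by rw [(Finset.mem_filter.1 hi).2], Finset.sum_const,
      nsmul_eq_mul]
    refine mul_le_mul_of_nonneg_right ?_ (by linarith [hM0 pq.1 pq.2])
    have : (Finset.filter (fun i => f i = pq) G).card ≤ 3 := by
      refine (Finset.card_le_card fun i hi => ?_).trans (hmult pq.1 pq.2)
      rw [Finset.mem_filter] at hi
      have := (hf i hi.1).1
      rw [hi.2] at this
      simpa using this
    exact_mod_cast this
  have h3 : ∑ pq : P × P, 3 * (4 * M pq.1 pq.2) = 12 * ∑ q, ∑ p, M p q := by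
    rw [Fintype.sum_prod_type, Finset.sum_comm]
    simp only [Finset.mul_sum]
    refine Finset.sum_congr rfl fun _ _ => Finset.sum_congr rfl fun _ _ => by ring
  have h4 : ∑ q, ∑ p, M p q ≤ ∑ q, if U q ≠ ⊥ then K * 2 else 0 := by
    refine Finset.sum_le_sum fun q _ => (hM2 q).trans ?_
    split_ifs with h
    · exact mul_le_mul_of_nonneg_left (by exact_mod_cast hU q) hK0
    · rw [not_not.1 h]
      simp
  rw [← Finset.sum_filter, Finset.sum_const, nsmul_eq_mul] at h4
  linarith

end Counting

section Corank

open Module Submodule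

variable {F : Type*} [AddCommGroup F] [Module ℝ F] [FiniteDimensional ℝ F]
  {E : Type*} [AddCommGroup E] [Module ℝ E] {P : Type*} [Fintype P]

lemma finrank_map_inf_add (g : F →ₗ[ℝ] E) (A : Submodule ℝ F) (H : Submodule ℝ E) :
    finrank ℝ ↥(A.map g ⊓ H) + finrank ℝ ↥(A ⊓ LinearMap.ker g) =
      finrank ℝ ↥(A ⊓ H.comap g) := by
  have h := LinearMap.finrank_range_add_finrank_ker (g.domRestrict (A ⊓ H.comap g))
  rw [LinearMap.range_domRestrict, ← map_inf_eq_map_inf_comap] at h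
  rw [← h, LinearMap.ker_domRestrict]
  congr 1
  rw [← finrank_map_subtype_eq (A ⊓ H.comap g), Submodule.map_comap_subtype]
  have : A ⊓ H.comap g ⊓ LinearMap.ker g = A ⊓ LinearMap.ker g := by
    rw [inf_assoc, inf_eq_right.2 (LinearMap.ker_le_comap (f := g))]
  rw [this]

open Classical in
theorem corank_le {A : P → Submodule ℝ F} (hA : ∀ p, finrank ℝ (A p) ≤ 2) (htop : ⨆ p, A p = ⊤)
    {ι : Type*} [Fintype ι] (tri : ι → Fin 3 → P) (φ : ι → Fin 3 → F)
    (hφ : ∀ i k, φ i k ∈ A (tri i k))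
    (hmult : ∀ p q, (Finset.univ.filter fun i =>
      ∃ k l, k ≠ l ∧ tri i k = p ∧ tri i l = q).card ≤ 3)
    {D K : ℝ} (hK : 0 ≤ K) (hKD : 72 * K + 6 < D)
    (hdeg : ∀ p, D ≤ (Finset.univ.filter fun i => ∃ k, tri i k = p).card)
    (hbad : ∀ p (H : Submodule ℝ F), ¬ A p ≤ H →
      (Finset.univ.filter fun i => ∃ k, tri i k = p ∧ φ i k ∈ H).card ≤ 6) :
    K * (finrank ℝ F - finrank ℝ (span ℝ (Set.range fun i => ∑ k, φ i k))) ≤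
      2 * Fintype.card P := by
  set R := span ℝ (Set.range fun i => ∑ k, φ i k)
  let Φ : Submodule ℝ F → ℝ := fun H => ∑ p, (finrank ℝ ↥(A p ⊓ H) : ℝ) - K * finrank ℝ H
  obtain ⟨H, ⟨hRH, hΦ⟩, hmax⟩ := WellFounded.has_min
    (wellFounded_gt (α := Submodule ℝ F)) {H | R ≤ H ∧ Φ R ≤ Φ H} ⟨R, le_rfl, le_rfl⟩
  by_cases hH : H = ⊤
  · have h1 : Φ ⊤ ≤ 2 * Fintype.card P - K * finrank ℝ F := by
      simp only [Φ, finrank_top]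
      refine sub_le_sub_right ((Finset.sum_le_sum fun p _ => ?_ : _ ≤ ∑ p : P, (2 : ℝ)).trans_eq
        (by simp [mul_comm])) _
      exact_mod_cast (Submodule.finrank_mono inf_le_left).trans (hA p)
    have h2 : -(K * finrank ℝ R) ≤ Φ R := by
      have : (0 : ℝ) ≤ ∑ p, (finrank ℝ ↥(A p ⊓ R) : ℝ) :=
        Finset.sum_nonneg fun _ _ => Nat.cast_nonneg _
      simp only [Φ]
      linarith
    rw [hH] at hΦ
    linarith
  exfalso
  have hstrict : ∀ H', H < H' → Φ H' < Φ H := fun H' hlt => by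
    by_contra! hle
    exact hmax H' ⟨hRH.trans hlt.le, hΦ.trans hle⟩ hlt
  let e := (finBasis ℝ (F ⧸ H)).equivFun.trans (WithLp.linearEquiv 2 ℝ _).symm
  let g : F →ₗ[ℝ] EuclideanSpace ℝ (Fin (finrank ℝ (F ⧸ H))) := e.toLinearMap ∘ₗ H.mkQ
  have hker : LinearMap.ker g = H := by
    simp only [g, LinearEquiv.ker_comp, ker_mkQ]
  have hg : Function.Surjective g := e.surjective.comp H.mkQ_surjective
  have hgz : ∀ x, g x = 0 ↔ x ∈ H := fun x => by rw [← LinearMap.mem_ker, hker]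
  have hKE : ∀ H'' : Submodule ℝ (EuclideanSpace ℝ (Fin (finrank ℝ (F ⧸ H)))), H'' ≠ ⊥ →
      ∑ p, (finrank ℝ ↥((A p).map g ⊓ H'') : ℝ) < K * finrank ℝ H'' := by
    intro H'' hne
    have hlt : H < H''.comap g := by
      refine lt_of_le_of_ne (hker.ge.trans (LinearMap.ker_le_comap (f := g))) fun h => hne ?_
      rw [← Submodule.map_comap_eq_of_surjective hg H'', ← h, ← le_bot_iff,
        Submodule.map_le_iff_le_comap,
        comap_bot, hker]
    have h1 := hstrict _ hlt
    have h2 := finrank_map_inf_add g ⊤ H''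
    rw [Submodule.map_top, LinearMap.range_eq_top.2 hg, top_inf_eq, top_inf_eq, top_inf_eq, hker]
      at h2
    simp only [Φ, ← h2] at h1
    have h3 : ∑ p, (finrank ℝ ↥(A p ⊓ H''.comap g) : ℝ) =
        ∑ p, (finrank ℝ ↥((A p).map g ⊓ H'') : ℝ) + ∑ p, (finrank ℝ ↥(A p ⊓ H) : ℝ) := by
      rw [← Finset.sum_add_distrib]
      refine Finset.sum_congr rfl fun p _ => ?_
      rw [← finrank_map_inf_add g (A p) H'', hker]
      push_cast
      rfl
    rw [h3] at h1
    push_cast at h1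
    linarith
  have hgood := card_good_triples_le (U := fun p => (A p).map g)
    (fun p => (finrank_map_le g (A p)).trans (hA p)) hK hKE tri (fun i k => g (φ i k))
    (fun i k => mem_map_of_mem (hφ i k))
    (fun i => by
      rw [← map_sum, hgz]
      exact hRH (subset_span ⟨i, rfl⟩)) hmult
  have hact : ∀ p, (A p).map g ≠ ⊥ ↔ ¬ A p ≤ H := fun p => by
    rw [Ne, ← le_bot_iff, Submodule.map_le_iff_le_comap, comap_bot, hker]
  simp only [hact, ne_eq, hgz] at hgood
  set act := Finset.univ.filter fun p => ¬ A p ≤ H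
  set good := Finset.univ.filter fun i => ∃ k, φ i k ∉ H
  have hactpos : (0 : ℝ) < act.card := by
    have : act.Nonempty := by
      by_contra hemp
      rw [Finset.not_nonempty_iff_eq_empty, Finset.filter_eq_empty_iff] at hemp
      exact hH (top_le_iff.1 (htop ▸ iSup_le fun p => not_not.1 (hemp (Finset.mem_univ p))))
    exact_mod_cast this.card_pos
  have hlow : ∀ p ∈ act, D - 6 ≤ ((good.filter fun i => ∃ k, tri i k = p).card : ℝ) := by
    intro p hp
    have h1 := hdeg p
    have h2 := hbad p H (by simpa [act] using hp)
    have h3 : (Finset.univ.filter fun i => ∃ k, tri i k = p) ⊆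
        (good.filter fun i => ∃ k, tri i k = p) ∪
          (Finset.univ.filter fun i => ∃ k, tri i k = p ∧ φ i k ∈ H) := by
      intro i hi
      obtain ⟨k, hk⟩ := (Finset.mem_filter.1 hi).2
      by_cases h : φ i k ∈ H
      · exact Finset.mem_union_right _ (by simpa using ⟨k, hk, h⟩)
      · exact Finset.mem_union_left _ (by simpa [good] using ⟨⟨k, h⟩, k, hk⟩)
    have h4 := (Finset.card_le_card h3).trans (Finset.card_union_le _ _)
    have h5 : ((Finset.univ.filter fun i => ∃ k, tri i k = p).card : ℝ) ≤
      (good.filter fun i => ∃ k, tri i k = p).card + 6 := by exact_mod_cast h4.trans (by omega)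
    linarith
  have hdc : ∑ p ∈ act, (good.filter fun i => ∃ k, tri i k = p).card ≤ 3 * good.card := by
    calc ∑ p ∈ act, (good.filter fun i => ∃ k, tri i k = p).card
        ≤ ∑ p, (good.filter fun i => ∃ k, tri i k = p).card :=
          Finset.sum_le_sum_of_subset (Finset.subset_univ _)
      _ = ∑ i ∈ good, (Finset.univ.filter fun p => ∃ k, tri i k = p).card :=
          Finset.sum_card_bipartiteAbove_eq_sum_card_bipartiteBelow
            (r := fun p i => ∃ k, tri i k = p)
      _ ≤ ∑ i ∈ good, 3 := by
          refine Finset.sum_le_sum fun i _ => ?_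
          have : (Finset.univ.filter fun p => ∃ k, tri i k = p) = Finset.univ.image (tri i) := by
            ext p; simp
          rw [this]
          exact Finset.card_image_le.trans (by simp)
      _ = 3 * good.card := by simp [mul_comm]
  have hfin : act.card * (D - 6) ≤ 3 * (good.card : ℝ) := by
    have h1 := Finset.sum_le_sum hlow
    rw [Finset.sum_const, nsmul_eq_mul] at h1
    exact h1.trans (by exact_mod_cast hdc)
  nlinarith

end Corank

section Trdeg

universe u

variable {k : Type*} [Field k]

lemma AlgebraicIndependent.option_of_algHom {A₀ A₁ : Type*} [CommRing A₀] [IsDomain A₀]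
    [CommRing A₁] [Algebra k A₀] [Algebra k A₁] (f : A₀ →ₐ[k] A₁) {ι : Type*} {y : ι → A₀}
    (hy : AlgebraicIndependent k (f ∘ y)) {a : A₀} (ha : a ≠ 0) (hfa : f a = 0) :
    AlgebraicIndependent k fun o : Option ι => o.elim a y := by
  rw [(hy.of_comp f).option_iff_transcendental]
  rintro ⟨q, hq0, hq⟩
  obtain ⟨g, hg, hndvd⟩ := q.exists_eq_pow_rootMultiplicity_mul_and_not_dvd hq0 0
  rw [Polynomial.C_0, sub_zero] at hg hndvd
  rw [Polynomial.X_dvd_iff] at hndvd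
  have hga : Polynomial.aeval a g = 0 := by
    rw [hg, map_mul, map_pow, Polynomial.aeval_X] at hq
    exact (mul_eq_zero.1 hq).resolve_left (pow_ne_zero _ ha)
  apply hndvd
  have h1 : f (g.coeff 0 : A₀) = 0 := by
    have h2 := congrArg f hga
    rw [map_zero, ← Polynomial.divX_mul_X_add g] at h2
    simpa [hfa] using h2
  obtain ⟨p, hp⟩ := (Algebra.adjoin_range_eq_range_aeval k y).le (g.coeff 0).2
  have hp' : aeval y p = (g.coeff 0 : A₀) := hp
  have h4 : aeval (f ∘ y) p = 0 := by
    rw [← h1, ← hp', ← AlgHom.comp_apply, comp_aeval]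
    rfl
  have h5 : p = 0 := (injective_iff_map_eq_zero _).1 hy p h4
  apply Subtype.ext
  rw [← hp', h5, map_zero]
  rfl

lemma exists_algebraicIndependent_of_chain {A : Type*} [CommRing A] [Algebra k A] :
    ∀ (n : ℕ) (p : Fin (n + 1) → Ideal A), (∀ i, (p i).IsPrime) → StrictMono p →
      ∃ y : Fin n → A ⧸ p 0, AlgebraicIndependent k y
  | 0, p, hp, _ => by
    have : Nontrivial (A ⧸ p 0) := Ideal.Quotient.nontrivial_iff.2 (hp 0).ne_top
    exact ⟨Fin.elim0, algebraicIndependent_empty_type_iff.2 (algebraMap k _).injective⟩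
  | n + 1, p, hp, hmono => by
    obtain ⟨y, hy⟩ := exists_algebraicIndependent_of_chain n (fun i => p i.succ)
      (fun i => hp _) (hmono.comp (Fin.strictMono_succ))
    have hlt : p 0 < p 1 := hmono (by simp)
    obtain ⟨a, ha1, ha0⟩ := Set.exists_of_ssubset hlt
    have := hp 0
    let f : A ⧸ p 0 →ₐ[k] A ⧸ p 1 := Ideal.Quotient.factorₐ k hlt.le
    have hf : Function.Surjective f := Ideal.Quotient.factor_surjective hlt.le
    choose z hz using fun i => hf (y i)
    have hz' : f ∘ z = y := funext hz
    have h := AlgebraicIndependent.option_of_algHom f (y := z) (a := Ideal.Quotient.mk _ a)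
      (hz' ▸ hy) (fun h => ha0 (Ideal.Quotient.eq_zero_iff_mem.1 h))
      (Ideal.Quotient.eq_zero_iff_mem.2 ha1)
    exact ⟨_, h.comp (finSuccEquiv n) (finSuccEquiv n).injective⟩

lemma trdeg_le_of_derivation {L : Type u} [Field L] [Algebra k L]
    [Algebra.EssFiniteType k L] (s : Set L)
    (h : ∀ (M : Type u) [AddCommGroup M] [Module k M] [Module L M] [IsScalarTower k L M]
      (D : Derivation k L M), (∀ x ∈ s, D x = 0) → D = 0) :
    Algebra.trdeg k L ≤ Cardinal.mk s := by
  let K := IntermediateField.adjoin k s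
  have : Algebra.EssFiniteType K L := Algebra.EssFiniteType.of_comp k K L
  have hD := h (Ω[L⁄K]) ((KaehlerDifferential.D K L).restrictScalars k) fun x hx =>
    (KaehlerDifferential.D K L).map_algebraMap ⟨x, IntermediateField.subset_adjoin k s hx⟩
  have hD' : ∀ x, KaehlerDifferential.D K L x = 0 := fun x => congrArg (fun D => D x) hD
  have : Algebra.FormallyUnramified K L := by
    refine ⟨?_⟩
    rw [← Submodule.subsingleton_iff L, ← subsingleton_iff_bot_eq_top,
      ← KaehlerDifferential.span_range_derivation K L, eq_comm, Submodule.span_eq_bot]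
    rintro _ ⟨x, rfl⟩
    exact hD' x
  have := Algebra.FormallyUnramified.isSeparable K L
  have h1 : Algebra.IsAlgebraic K L := inferInstance
  have := IntermediateField.isAlgebraic_adjoin_iff_top.1 h1
  exact Algebra.IsAlgebraic.trdeg_le_cardinalMk k s

end Trdeg

section Rigidity

universe u

open Module

variable {S : Type u} {R : Type*} [CommRing R]

open Classical in
/-- The part supported on the `k`-th point of the gradient of `collinearityDet` at `ξ`. -/
def gradPart (ξ : S × Fin 2 → R) (t : Fin 3 → S) (k : Fin 3) : S × Fin 2 → R :=
  fun j => if j.1 = t k then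
    (if j.2 = 0 then ξ (t (k + 1), 1) - ξ (t (k + 2), 1) else ξ (t (k + 2), 0) - ξ (t (k + 1), 0))
    else 0

/-- The determinant expressing collinearity of three points with coordinates `ξ`. -/
def collinearityDet (ξ : S × Fin 2 → R) (t : Fin 3 → S) : R :=
  (ξ (t 1, 0) - ξ (t 0, 0)) * (ξ (t 2, 1) - ξ (t 0, 1)) -
    (ξ (t 1, 1) - ξ (t 0, 1)) * (ξ (t 2, 0) - ξ (t 0, 0))

lemma map_gradPart {R' : Type*} [CommRing R'] (f : R →+* R') (ξ : S × Fin 2 → R) (t : Fin 3 → S)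
    (k : Fin 3) (j : S × Fin 2) : f (gradPart ξ t k j) = gradPart (f ∘ ξ) t k j := by
  simp only [gradPart]
  split_ifs <;> simp

lemma map_collinearityDet {R' : Type*} [CommRing R'] (f : R →+* R') (ξ : S × Fin 2 → R)
    (t : Fin 3 → S) : f (collinearityDet ξ t) = collinearityDet (f ∘ ξ) t := by
  simp [collinearityDet]

lemma derivation_collinearityDet [Fintype S] {k M : Type*} [CommRing k] [Algebra k R]
    [AddCommGroup M] [Module k M] [Module R M] (D : Derivation k R M)
    (ξ : S × Fin 2 → R) (t : Fin 3 → S) :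
    D (collinearityDet ξ t) = ∑ j, (∑ i, gradPart ξ t i j) • D (ξ j) := by
  classical
  simp only [Finset.sum_smul]
  rw [Finset.sum_comm]
  simp only [Fintype.sum_prod_type, gradPart, Fin.sum_univ_two, ite_smul, zero_smul,
    Finset.sum_add_distrib, Finset.sum_ite_eq', Finset.mem_univ, if_true, Fin.sum_univ_three,
    collinearityDet, map_sub, Derivation.leibniz, one_ne_zero, if_false]
  have h1 : (1 : Fin 3) + 1 = 2 := rfl
  have h2 : (1 : Fin 3) + 2 = 0 := rfl
  have h3 : (2 : Fin 3) + 1 = 0 := rfl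
  have h4 : (2 : Fin 3) + 2 = 1 := rfl
  simp only [zero_add, h1, h2, h3, h4]
  module

lemma collinearityDet_eq_zero {Q : S → ℂ × ℂ} {t : Fin 3 → S}
    (h : Collinear ℂ (Q '' {t 0, t 1, t 2})) : collinearityDet (flatten Q) t = 0 := by
  rw [Set.image_insert_eq, Set.image_pair] at h
  obtain ⟨v, hv⟩ := (collinear_iff_of_mem (p₀ := Q (t 0)) (by simp)).1 h
  obtain ⟨a, ha⟩ := hv (Q (t 1)) (by simp)
  obtain ⟨b, hb⟩ := hv (Q (t 2)) (by simp)
  simp only [collinearityDet, flatten, ha, hb]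
  simp
  ring

/-- The ideal of polynomials vanishing on `V`. -/
def vanishing (V : Set (S → ℂ × ℂ)) : Ideal (MvPolynomial (S × Fin 2) ℂ) where
  carrier := {f | ∀ Q ∈ V, eval (flatten Q) f = 0}
  add_mem' := fun hf hg Q hQ => by rw [map_add, hf Q hQ, hg Q hQ, add_zero]
  zero_mem' := fun Q _ => map_zero _
  smul_mem' := fun c f hf Q hQ => by rw [smul_eq_mul, map_mul, hf Q hQ, mul_zero]

lemma vanishing_anti {V W : Set (S → ℂ × ℂ)} (h : V ⊆ W) : vanishing W ≤ vanishing V :=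
  fun _ hf Q hQ => hf Q (h hQ)

lemma ZClosed.subset_of_vanishing_le {V W : Set (S → ℂ × ℂ)} (hW : ZClosed W)
    (h : vanishing W ≤ vanishing V) : V ⊆ W := by
  obtain ⟨I, rfl⟩ := hW
  exact fun Q hQ f hf => h (fun Q' hQ' => hQ' f hf) Q hQ

lemma ZIrred.isPrime {V : Set (S → ℂ × ℂ)} (hV : ZIrred V) : (vanishing V).IsPrime := by
  obtain ⟨-, ⟨Q₀, hQ₀⟩, h⟩ := hV
  refine Ideal.isPrime_iff.2 ⟨fun htop => ?_, fun {f g} hfg => ?_⟩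
  · have : (1 : MvPolynomial (S × Fin 2) ℂ) ∈ vanishing V := htop ▸ trivial
    simpa using this Q₀ hQ₀
  · have hcl : ∀ f : MvPolynomial (S × Fin 2) ℂ, ZClosed {Q | eval (flatten Q) f = 0} :=
      fun f => ⟨{f}, by simp⟩
    refine h _ _ (hcl f) (hcl g) fun Q hQ => ?_
    have := hfg Q hQ
    rwa [map_mul, mul_eq_zero] at this

lemma ZDimLE.of_algebraicIndependent {V : Set (S → ℂ × ℂ)} {r : ℕ}
    (h : ∀ n (y : Fin n → MvPolynomial (S × Fin 2) ℂ ⧸ vanishing V),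
      AlgebraicIndependent ℂ y → n ≤ r) : ZDimLE V r := by
  intro n c hirr hsub hmono
  obtain ⟨y, hy⟩ := exists_algebraicIndependent_of_chain (k := ℂ) n
    (fun i => vanishing (c i.rev)) (fun i => (hirr _).isPrime) (fun i j hij => by
      have hlt : c j.rev < c i.rev := hmono (Fin.rev_lt_rev.2 hij)
      refine lt_of_le_not_ge (vanishing_anti hlt.le) fun hle => ?_
      exact hlt.not_ge ((hirr j.rev).1.subset_of_vanishing_le hle))
  let f : MvPolynomial (S × Fin 2) ℂ ⧸ vanishing V →ₐ[ℂ] _ :=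
    Ideal.Quotient.factorₐ ℂ (vanishing_anti (hsub (Fin.rev 0)))
  have hf : Function.Surjective f := 
    Ideal.Quotient.factor_surjective (vanishing_anti (hsub (Fin.rev 0)))
  choose z hz using fun i => hf (y i)
  exact h n z (AlgebraicIndependent.of_comp f (by rwa [show f ∘ z = y from funext hz]))


lemma trdeg_fractionRing_le {I : Ideal (MvPolynomial (S × Fin 2) ℂ)} [I.IsPrime] [Finite S]
    (B : Finset (S × Fin 2))
    (h : ∀ (M : Type u) [AddCommGroup M] [Module ℂ M]
      [Module (FractionRing (MvPolynomial (S × Fin 2) ℂ ⧸ I)) M]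
      [IsScalarTower ℂ (FractionRing (MvPolynomial (S × Fin 2) ℂ ⧸ I)) M]
      (D : Derivation ℂ (FractionRing (MvPolynomial (S × Fin 2) ℂ ⧸ I)) M),
      (∀ b ∈ B, D (algebraMap (MvPolynomial (S × Fin 2) ℂ) _ (X b)) = 0) →
      ∀ j, D (algebraMap (MvPolynomial (S × Fin 2) ℂ) _ (X j)) = 0) :
    Algebra.trdeg ℂ (FractionRing (MvPolynomial (S × Fin 2) ℂ ⧸ I)) ≤ B.card := by
  have : Algebra.EssFiniteType ℂ (FractionRing (MvPolynomial (S × Fin 2) ℂ ⧸ I)) := by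
    have := Algebra.EssFiniteType.of_isLocalization
      (FractionRing (MvPolynomial (S × Fin 2) ℂ ⧸ I))
      (nonZeroDivisors (MvPolynomial (S × Fin 2) ℂ ⧸ I))
    exact Algebra.EssFiniteType.comp ℂ (MvPolynomial (S × Fin 2) ℂ ⧸ I) _
  refine (trdeg_le_of_derivation ((fun b : S × Fin 2 => algebraMap (MvPolynomial (S × Fin 2) ℂ)
    (FractionRing (MvPolynomial (S × Fin 2) ℂ ⧸ I)) (X b)) '' B) ?_).trans ?_
  · intro M _ _ _ _ D hD
    have hX := h M D fun b hb => hD _ ⟨b, hb, rfl⟩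
    have hpoly (f : MvPolynomial (S × Fin 2) ℂ) :
        D (algebraMap (MvPolynomial (S × Fin 2) ℂ) _ f) = 0 := by
      induction f using MvPolynomial.induction_on with
      | C a =>
        rw [← MvPolynomial.algebraMap_eq, ← IsScalarTower.algebraMap_apply]
        exact D.map_algebraMap a
      | add f g hf hg => rw [map_add, map_add, hf, hg, add_zero]
      | mul_X f j hf => rw [map_mul, D.leibniz, hf, hX, smul_zero, smul_zero, add_zero]
    ext z
    obtain ⟨a, b, -, rfl⟩ := IsFractionRing.div_surjective
      (A := MvPolynomial (S × Fin 2) ℂ ⧸ I) z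
    obtain ⟨a, rfl⟩ := Ideal.Quotient.mk_surjective a
    obtain ⟨b, rfl⟩ := Ideal.Quotient.mk_surjective b
    have ha := hpoly a
    have hb := hpoly b
    rw [IsScalarTower.algebraMap_apply _ (MvPolynomial (S × Fin 2) ℂ ⧸ I)] at ha hb
    rw [div_eq_mul_inv, D.leibniz, D.leibniz_inv]
    simp only [Ideal.Quotient.algebraMap_eq] at ha hb
    simp [ha, hb]
  · exact Cardinal.mk_image_le.trans (by simp)

open Classical in
/-- The gradients of the collinearity determinants of the triples `tri` at `ξ`, followed by the
coordinate vectors in `B`. -/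
def gradRows {ι : Type*} (tri : ι → Fin 3 → S) (B : Finset (S × Fin 2)) (ξ : S × Fin 2 → R) :
    Matrix (ι ⊕ B) (S × Fin 2) R :=
  Matrix.of (Sum.elim (fun i => ∑ k, gradPart ξ (tri i) k) (fun b => Pi.single b.1 1))

lemma map_gradRows {ι R' : Type*} [CommRing R'] (f : R →+* R') (tri : ι → Fin 3 → S)
    (B : Finset (S × Fin 2)) (ξ : S × Fin 2 → R) (i : ι ⊕ B) (j : S × Fin 2) :
    f (gradRows tri B ξ i j) = gradRows tri B (f ∘ ξ) i j := by
  rcases i with i | b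
  · simp [gradRows, map_gradPart]
  · simp [gradRows, Pi.single_apply]

/-- If the collinearity gradients at a point `Q` of `V` span the cotangent space together with
the coordinates in `B`, then the dimension of the variety `V` is at most `|B|`. -/
lemma ZDimLE.of_gradients [Fintype S] {ι : Type*} [Fintype ι] [DecidableEq S]
    {V : Set (S → ℂ × ℂ)} (hV : ZIrred V) (tri : ι → Fin 3 → S)
    (hdet : ∀ Q ∈ V, ∀ i, collinearityDet (flatten Q) (tri i) = 0)
    {Q : S → ℂ × ℂ} (hQ : Q ∈ V) (B : Finset (S × Fin 2))
    (N : Matrix (S × Fin 2) (ι ⊕ B) ℂ)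
    (hN : N * gradRows tri B (flatten Q) = 1) :
    ZDimLE V B.card := by
  have hprime := hV.isPrime
  refine ZDimLE.of_algebraicIndependent fun n y hy => ?_
  set L := FractionRing (MvPolynomial (S × Fin 2) ℂ ⧸ vanishing V)
  have hy' : AlgebraicIndependent ℂ
      ((IsScalarTower.toAlgHom ℂ (MvPolynomial (S × Fin 2) ℂ ⧸ vanishing V) L) ∘ y) :=
    hy.map' (IsFractionRing.injective _ L)
  have hcard := hy'.lift_cardinalMk_le_trdeg
  suffices hB : Algebra.trdeg ℂ L ≤ B.card by
    have := hcard.trans (Cardinal.lift_le.2 hB)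
    simpa using this
  refine trdeg_fractionRing_le B fun M _ _ _ _ D hD j₀ => ?_
  let a : MvPolynomial (S × Fin 2) ℂ →+* L := algebraMap _ L
  have ha (f : MvPolynomial (S × Fin 2) ℂ) : a f = 0 ↔ f ∈ vanishing V := by
    simp only [a]
    rw [IsScalarTower.algebraMap_apply _ (MvPolynomial (S × Fin 2) ℂ ⧸ vanishing V),
      map_eq_zero_iff _ (IsFractionRing.injective _ L), Ideal.Quotient.algebraMap_eq,
      Ideal.Quotient.eq_zero_iff_mem]
  have hrow (i) : ∑ j, gradRows tri B (a ∘ X) i j • D (a (X j)) = 0 := by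
    rcases i with i | b
    · have h0 : collinearityDet (a ∘ X) (tri i) = 0 := by
        rw [← map_collinearityDet, ha]
        intro Q' hQ'
        rw [map_collinearityDet]
        convert hdet Q' hQ' i
        ext
        simp
      have h1 := derivation_collinearityDet D (a ∘ X) (tri i)
      rw [h0, map_zero] at h1
      simpa [gradRows] using h1.symm
    · rw [Finset.sum_eq_single b.1]
      · simpa [gradRows] using hD b b.2
      · intro j _ hj
        have h0 : gradRows tri B (a ∘ X) (Sum.inr b) j = 0 := by
          simp [gradRows, Pi.single, Function.update, hj]
        rw [h0, zero_smul]
      · simp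
  set G : Matrix (S × Fin 2) (S × Fin 2) (MvPolynomial (S × Fin 2) ℂ) :=
    (N.map C : Matrix _ _ (MvPolynomial (S × Fin 2) ℂ)) *
      (gradRows tri B X : Matrix _ _ (MvPolynomial (S × Fin 2) ℂ)) with hG
  have hGdet : a G.det ≠ 0 := by
    rw [Ne, ha]
    intro hmem
    have h1 := hmem Q hQ
    have h2 : (eval (flatten Q)).mapMatrix G = 1 := by
      rw [← hN]
      ext i j
      simp only [hG, RingHom.mapMatrix_apply, Matrix.map_apply, Matrix.mul_apply, map_sum,
        map_mul, eval_C, map_gradRows]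
      congr! 3
      ext
      simp
    rw [RingHom.map_det, h2, Matrix.det_one] at h1
    exact one_ne_zero h1
  have hGD (i) : ∑ j, a (G i j) • D (a (X j)) = 0 := by
    simp only [hG, Matrix.mul_apply, map_sum, map_mul, map_gradRows,
      Finset.sum_smul, mul_smul]
    rw [Finset.sum_comm]
    simp only [← Finset.smul_sum, hrow, smul_zero, Finset.sum_const_zero]
  have hadj : a G.det • D (a (X j₀)) = 0 := by
    have : ∑ i, a (G.adjugate j₀ i) • ∑ j, a (G i j) • D (a (X j)) = 0 := by
      simp [hGD]
    simp only [Finset.smul_sum, smul_smul, ← map_mul] at this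
    rw [Finset.sum_comm] at this
    simp only [← Finset.sum_smul, ← map_sum, ← Matrix.mul_apply, Matrix.adjugate_mul,
      Matrix.smul_apply, Matrix.one_apply] at this
    rw [Finset.sum_eq_single j₀] at this
    · simpa using this
    · intro j _ hj
      simp [hj.symm]
    · simp
  exact (smul_eq_zero.1 hadj).resolve_left hGdet

end Rigidity

section RigidityCriterion

universe u

open Module Submodule

lemma exists_coordinates_sup_eq_top {J k : Type*} [Fintype J] [DecidableEq J] [Field k]
    (W : Submodule k (J → k)) :
    ∃ B : Finset J, B.card + finrank k W = Fintype.card J ∧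
      W ⊔ span k ((fun b => Pi.single b 1) '' (B : Set J)) = ⊤ := by
  obtain ⟨K, a, ha, hspan, hli⟩ := exists_linearIndependent' k
    (fun j : J => W.mkQ (Pi.single j (1 : k)))
  have : Finite K := Finite.of_injective a ha
  have := Fintype.ofFinite K
  have hrange : span k (Set.range fun j : J => (Pi.single j 1 : J → k)) = ⊤ := by
    rw [← (Pi.basisFun k J).span_eq]
    congr! with j
    simp
  have htop : span k (Set.range ((fun j : J => W.mkQ (Pi.single j (1 : k))) ∘ a)) = ⊤ := by
    rw [hspan, show (fun j : J => W.mkQ (Pi.single j (1 : k))) = W.mkQ ∘ fun j => Pi.single j 1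
      from rfl, Set.range_comp, span_image, hrange, Submodule.map_top, range_mkQ]
  refine ⟨Finset.univ.map ⟨a, ha⟩, ?_, ?_⟩
  · rw [Finset.card_map, Finset.card_univ, ← finrank_span_eq_card hli, htop, finrank_top,
      W.finrank_quotient_add_finrank, finrank_fintype_fun_eq_card]
  · rw [← map_mkQ_eq_top, map_span, ← htop, ← Set.image_comp, Finset.coe_map, Finset.coe_univ,
      Set.image_univ, ← Set.range_comp]
    rfl

/-- The real coordinates of a configuration of points of the plane. -/
def coords {S : Type*} (x : S → ℝ × ℝ) : S × Fin 2 → ℝ :=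
  fun j => if j.2 = 0 then (x j.1).1 else (x j.1).2

lemma isRigid_of_finrank_gradients {S : Type u} [Fintype S] {T : Set (Set S)}
    {ι : Type*} [Fintype ι] (tri : ι → Fin 3 → S) (htri : ∀ i, {tri i 0, tri i 1, tri i 2} ∈ T)
    (x : S → ℝ × ℝ) (hP : (fun s => emb (x s)) ∈ KT T) {d : ℕ}
    (hd : 2 * Fintype.card S ≤ d + finrank ℝ (span ℝ (Set.range fun i => ∑ k,
      gradPart (coords x) (tri i) k))) :
    IsRigid T (fun s => emb (x s)) d := by
  classical
  set ξ : S × Fin 2 → ℝ := coords x with hξ_def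
  have hξ : flatten (fun s => emb (x s)) = Complex.ofRealHom ∘ ξ := by
    ext j
    simp only [flatten, emb, hξ_def, coords, Function.comp_apply]
    split_ifs <;> rfl
  obtain ⟨B, hB, htop⟩ := exists_coordinates_sup_eq_top
    (span ℝ (Set.range fun i => ∑ k, gradPart ξ (tri i) k))
  let rows : ι ⊕ B → S × Fin 2 → ℝ :=
    Sum.elim (fun i => ∑ k, gradPart ξ (tri i) k) fun b => Pi.single b.1 1
  have hrows (i j) : gradRows tri B ξ i j = rows i j := by
    rcases i with i | b
    · rfl
    · simp [gradRows, rows, Pi.single_apply]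
  have hspan : span ℝ (Set.range rows) = ⊤ := by
    rw [← htop, Set.Sum.elim_range, span_union, Set.image_eq_range]
    rfl
  have hN (j : S × Fin 2) : ∃ c : ι ⊕ B → ℝ, ∑ i, c i • rows i = Pi.single j 1 := by
    rw [← mem_span_range_iff_exists_fun, hspan]
    trivial
  choose N hN using hN
  refine ⟨hP, fun V hV hQ n c h1 h2 h3 => ?_⟩
  have hdim := ZDimLE.of_gradients hV.1 tri (fun Q' hQ' i => collinearityDet_eq_zero
    (hV.2.1 hQ' _ (htri i))) hQ B ((Matrix.of N).map Complex.ofRealHom) (by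
      rw [hξ]
      ext i j
      rw [← Matrix.map_one Complex.ofRealHom (map_zero _) (map_one _)]
      simp only [Matrix.mul_apply, ← map_gradRows, Matrix.map_apply, ← map_mul, ← map_sum]
      congr 1
      have := congrFun (hN i) j
      simp only [Finset.sum_apply, Pi.smul_apply, smul_eq_mul, Pi.single_apply, hrows,
        Matrix.one_apply, Matrix.of_apply] at this ⊢
      simpa [eq_comm] using this)
  have := hdim n c h1 h2 h3
  simp only [Fintype.card_prod, Fintype.card_fin] at hB
  omega

end RigidityCriterion

section ConsecutiveTriples

open Module Submodule

variable {P : Set (ℝ × ℝ)}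

lemma sbtw_add_smul {p d : ℝ × ℝ} (hd : d ≠ 0) {a b : ℝ} (ha : 0 < a) (hab : a < b) :
    Sbtw ℝ p (p + a • d) (p + b • d) := by
  have h : Function.Injective (AffineMap.lineMap (k := ℝ) p (p + d)) :=
    AffineMap.lineMap_injective ℝ (by simpa [eq_comm] using hd)
  have := h.sbtw_map_iff.2 (Sbtw.of_lt_of_lt ha hab)
  simpa [AffineMap.lineMap_apply, add_comm] using this

lemma ConsecTriple.symm {x y z : ℝ × ℝ} (h : ConsecTriple P x y z) : ConsecTriple P z y x :=
  ⟨h.2.2.1, h.2.1, h.1, h.2.2.2.1.symm, fun w hw hs => h.2.2.2.2 w hw hs.symm⟩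

lemma ConsecTriple.eq_right {x y z z' : ℝ × ℝ} (h : ConsecTriple P x y z)
    (h' : ConsecTriple P x y z') : z = z' := by
  have key : ∀ {z z' : ℝ × ℝ} {a b : ℝ}, ConsecTriple P x y z →
      ConsecTriple P x y z' → 1 < a → a < b →
      AffineMap.lineMap x y a = z → AffineMap.lineMap x y b = z' → False := by
    intro z z' a b hz hz' ha hab hza hzb
    refine hz.2.2.2.1.ne_right (hz'.2.2.2.2 z hz.2.2.1 ?_).symm
    have := sbtw_add_smul (p := x) (sub_ne_zero.2 hz.2.2.2.1.left_ne.symm)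
      (zero_lt_one.trans ha) hab
    rw [← hza, ← hzb]
    simpa [AffineMap.lineMap_apply, add_comm] using this
  obtain ⟨-, a, ha, hza⟩ := sbtw_iff_left_ne_and_right_mem_image_Ioi.1 h.2.2.2.1
  obtain ⟨-, b, hb, hzb⟩ := sbtw_iff_left_ne_and_right_mem_image_Ioi.1 h'.2.2.2.1
  rcases lt_trichotomy a b with hab | rfl | hab
  · exact (key h h' ha hab hza hzb).elim
  · rw [← hza, hzb]
  · exact (key h' h hb hab hzb hza).elim

/-- All differences of the points of a consecutive triple are multiples of one vector. -/
lemma ConsecTriple.exists_direction {x : Fin 3 → ℝ × ℝ} (h : ConsecTriple P (x 0) (x 1) (x 2)) :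
    ∃ d : ℝ × ℝ, d ≠ 0 ∧ ∀ k l, k ≠ l → ∃ a : ℝ, a ≠ 0 ∧ x l - x k = a • d := by
  obtain ⟨⟨s, ⟨h0, h1⟩, hs⟩, hne⟩ := sbtw_iff_mem_image_Ioo_and_ne.1 h.2.2.2.1
  rw [AffineMap.lineMap_apply, vsub_eq_sub, vadd_eq_add] at hs
  refine ⟨x 2 - x 0, sub_ne_zero.2 hne.symm, fun k l hkl => ?_⟩
  fin_cases k <;> fin_cases l <;> simp only [Fin.zero_eta, Fin.mk_one, Fin.reduceFinMk] at hkl ⊢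
  · exact (hkl rfl).elim
  · exact ⟨s, h0.ne', by rw [← hs]; simp⟩
  · exact ⟨1, one_ne_zero, by simp⟩
  · exact ⟨-s, by linarith, by rw [← hs]; module⟩
  · exact (hkl rfl).elim
  · exact ⟨1 - s, by linarith, by rw [← hs]; module⟩
  · exact ⟨-1, by norm_num, by module⟩
  · exact ⟨s - 1, by linarith, by rw [← hs]; module⟩
  · exact (hkl rfl).elim

lemma ConsecTriple.exists_adjacent {x : Fin 3 → ℝ × ℝ} (h : ConsecTriple P (x 0) (x 1) (x 2))
    (k : Fin 3) : ∃ l, l ≠ k ∧ ∀ w ∈ P, ¬ Sbtw ℝ (x k) w (x l) := by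
  have h01 : ∀ w ∈ P, ¬ Sbtw ℝ (x 0) w (x 1) := fun w hw hs =>
    hs.ne_right (h.2.2.2.2 w hw (h.2.2.2.1.trans_left hs))
  have h21 : ∀ w ∈ P, ¬ Sbtw ℝ (x 2) w (x 1) := fun w hw hs =>
    hs.ne_right (h.2.2.2.2 w hw (h.2.2.2.1.symm.trans_left hs).symm)
  fin_cases k
  · exact ⟨1, by decide, h01⟩
  · exact ⟨0, by decide, fun w hw hs => h01 w hw hs.symm⟩
  · exact ⟨1, by decide, h21⟩

variable {S ι : Type*} [Fintype ι] {x : S → ℝ × ℝ} {tri : ι → Fin 3 → S}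

open Classical in
/-- A pair of points lies in at most three consecutive triples. -/
lemma card_filter_pair_le (htri : ∀ i, ConsecTriple P (x (tri i 0)) (x (tri i 1)) (x (tri i 2)))
    (hinj : Function.Injective fun i =>
      ({x (tri i 0), x (tri i 1), x (tri i 2)} : Set (ℝ × ℝ))) (p q : S) :
    (Finset.univ.filter fun i => ∃ k l, k ≠ l ∧ tri i k = p ∧ tri i l = q).card ≤ 3 := by
  let s : ι → Set (ℝ × ℝ) := fun i => {x (tri i 0), x (tri i 1), x (tri i 2)}
  have hsub : (Finset.univ.filter fun i => ∃ k l, k ≠ l ∧ tri i k = p ∧ tri i l = q) ⊆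
      (Finset.univ.filter fun i => ∃ r, s i = {x p, x q, r} ∧ ConsecTriple P (x p) (x q) r) ∪
      ((Finset.univ.filter fun i => ∃ r, s i = {x p, x q, r} ∧ ConsecTriple P (x p) r (x q)) ∪
      (Finset.univ.filter fun i => ∃ r, s i = {x p, x q, r} ∧ ConsecTriple P (x q) (x p) r)) := by
    intro i hi
    simp only [Finset.mem_filter, Finset.mem_univ, true_and, Finset.mem_union] at hi ⊢
    obtain ⟨k, l, hkl, rfl, rfl⟩ := hi
    have h := htri i
    fin_cases k <;> fin_cases l <;> simp only [Fin.zero_eta, Fin.mk_one, Fin.reduceFinMk] at hkl ⊢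
    · exact (hkl rfl).elim
    · exact Or.inl ⟨_, rfl, h⟩
    · exact Or.inr (Or.inl ⟨_, by simp only [s]; grind, h⟩)
    · exact Or.inr (Or.inr ⟨_, by simp only [s]; grind, h⟩)
    · exact (hkl rfl).elim
    · exact Or.inr (Or.inr ⟨_, by simp only [s]; grind, h.symm⟩)
    · exact Or.inr (Or.inl ⟨_, by simp only [s]; grind, h.symm⟩)
    · exact Or.inl ⟨_, by simp only [s]; grind, h.symm⟩
    · exact (hkl rfl).elim
  refine (Finset.card_le_card hsub).trans ((Finset.card_union_le _ _).trans
    ((add_le_add_right (Finset.card_union_le _ _) _).trans ?_))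
  refine add_le_add (a := _) (b := 1) (c := _) (d := 2) ?_
    (add_le_add (a := _) (b := 1) (c := _) (d := 1) ?_ ?_) <;>
  · refine Finset.card_le_one.2 fun i hi j hj => hinj ?_
    simp only [Finset.mem_filter, Finset.mem_univ, true_and] at hi hj
    obtain ⟨r, hr, hc⟩ := hi
    obtain ⟨r', hr', hc'⟩ := hj
    have : r = r' := by
      first
      | exact hc.eq_right hc'
      | exact hc'.2.2.2.2 r hc.2.1 hc.2.2.2.1
    exact hr.trans (this ▸ hr'.symm)

open Classical in
/-- The vector `d` turned by a right angle, placed in the plane of coordinates of the point `p`. -/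
def rotated (p : S) (d : ℝ × ℝ) : S × Fin 2 → ℝ :=
  (-d.2) • Pi.single (p, 0) 1 + d.1 • Pi.single (p, 1) 1

open Classical in
/-- The plane of coordinates of the point `p`. -/
def coordPlane (p : S) : Submodule ℝ (S × Fin 2 → ℝ) :=
  span ℝ {Pi.single (p, 0) 1, Pi.single (p, 1) 1}

lemma rotated_mem_coordPlane (p : S) (d : ℝ × ℝ) : rotated p d ∈ coordPlane p :=
  add_mem (smul_mem _ _ (subset_span (by simp))) (smul_mem _ _ (subset_span (by simp)))

lemma finrank_coordPlane_le (p : S) : finrank ℝ (coordPlane p) ≤ 2 := by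
  classical
  have h := finrank_span_finset_le_card (R := ℝ)
    ({Pi.single (p, 0) 1, Pi.single (p, 1) 1} : Finset (S × Fin 2 → ℝ))
  rw [Finset.coe_pair] at h
  refine (le_of_eq ?_).trans (h.trans Finset.card_le_two)
  rw [Set.finrank, coordPlane]

lemma iSup_coordPlane [Fintype S] : ⨆ p : S, coordPlane p = ⊤ := by
  classical
  rw [eq_top_iff, ← (Pi.basisFun ℝ (S × Fin 2)).span_eq, span_le]
  rintro _ ⟨⟨p, c⟩, rfl⟩
  refine mem_iSup_of_mem p (subset_span ?_)
  fin_cases c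
  · left; simp
  · right; simp

lemma coordPlane_le {p : S} {d e : ℝ × ℝ} {H : Submodule ℝ (S × Fin 2 → ℝ)}
    (hd : rotated p d ∈ H) (he : rotated p e ∈ H) (hde : d.1 * e.2 - d.2 * e.1 ≠ 0) :
    coordPlane p ≤ H := by
  classical
  rw [coordPlane, span_le, Set.pair_subset_iff]
  constructor
  · refine (H.smul_mem_iff hde).1 ?_
    convert H.sub_mem (H.smul_mem e.1 hd) (H.smul_mem d.1 he) using 1
    rw [rotated, rotated]
    module
  · refine (H.smul_mem_iff hde).1 ?_
    convert H.sub_mem (H.smul_mem e.2 hd) (H.smul_mem d.2 he) using 1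
    rw [rotated, rotated]
    module

lemma gradPart_coords {t : Fin 3 → S} {k : Fin 3} {d : ℝ × ℝ} {a : ℝ}
    (h : x (t (k + 2)) - x (t (k + 1)) = a • d) :
    gradPart (coords x) t k = a • rotated (t k) d := by
  have h1 := congrArg Prod.fst h
  have h2 := congrArg Prod.snd h
  simp only [Prod.fst_sub, Prod.snd_sub, Prod.smul_fst, Prod.smul_snd, smul_eq_mul] at h1 h2
  ext ⟨q, c⟩
  fin_cases c <;> by_cases hq : q = t k <;>
    simp [gradPart, rotated, coords, hq] <;> linarith

lemma gradPart_mem_coordPlane (t : Fin 3 → S) (k : Fin 3) :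
    gradPart (coords x) t k ∈ coordPlane (t k) := by
  rw [gradPart_coords (a := 1) (one_smul _ _).symm, one_smul]
  exact rotated_mem_coordPlane _ _

open Classical in
lemma card_filter_adjacent_le_one [Fintype S] (hx : Function.Injective x) (hxP : ∀ s, x s ∈ P)
    (p : S) {d : ℝ × ℝ} (hd : d ≠ 0) :
    (Finset.univ.filter fun q => (∃ a : ℝ, 0 < a ∧ x q - x p = a • d) ∧
      ∀ w ∈ P, ¬ Sbtw ℝ (x p) w (x q)).card ≤ 1 := by
  have key : ∀ {q q' : S} {a b : ℝ}, 0 < a → x q - x p = a • d → x q' - x p = b • d →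
      (∀ w ∈ P, ¬ Sbtw ℝ (x p) w (x q')) → ¬ a < b := by
    intro q q' a b ha hqa hqb hq' hab
    refine hq' (x q) (hxP q) ?_
    rw [sub_eq_iff_eq_add'.1 hqa, sub_eq_iff_eq_add'.1 hqb]
    exact sbtw_add_smul hd ha hab
  refine Finset.card_le_one.2 fun q hq q' hq' => hx ?_
  simp only [Finset.mem_filter, Finset.mem_univ, true_and] at hq hq'
  obtain ⟨⟨a, ha, hqa⟩, hq⟩ := hq
  obtain ⟨⟨b, hb, hqb⟩, hq'⟩ := hq'
  have hab : a = b := le_antisymm (not_lt.1 (key hb hqb hqa hq)) (not_lt.1 (key ha hqa hqb hq'))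
  rw [← sub_left_inj (a := x p), hqa, hqb, hab]

lemma exists_smul_eq_of_cross_eq_zero {d e : ℝ × ℝ} (he : e ≠ 0) (hd : d ≠ 0)
    (h : d.1 * e.2 - d.2 * e.1 = 0) : ∃ a : ℝ, a ≠ 0 ∧ e = a • d := by
  obtain ⟨a, rfl⟩ : ∃ a : ℝ, e = a • d := by
    by_cases h1 : d.1 = 0
    · have h2 : d.2 ≠ 0 := fun h2 => hd (Prod.ext h1 h2)
      refine ⟨e.2 / d.2, Prod.ext ?_ ?_⟩
      · have : d.2 * e.1 = 0 := by rw [h1] at h; linarith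
        simp [h1, (mul_eq_zero.1 this).resolve_left h2]
      · simp [h2]
    · refine ⟨e.1 / d.1, Prod.ext (by simp [h1]) ?_⟩
      simp only [Prod.smul_snd, smul_eq_mul]
      field_simp
      linarith
  exact ⟨a, fun h0 => he (by rw [h0, zero_smul]), rfl⟩

open Classical in
/-- At most six of the gradients at a point can lie in a subspace meeting the plane of coordinates
of that point in at most a line. -/
lemma card_filter_gradPart_mem_le [Fintype S] (hx : Function.Injective x) (hxP : ∀ s, x s ∈ P)
    (htri : ∀ i, ConsecTriple P (x (tri i 0)) (x (tri i 1)) (x (tri i 2)))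
    (hinj : Function.Injective fun i =>
      ({x (tri i 0), x (tri i 1), x (tri i 2)} : Set (ℝ × ℝ)))
    (p : S) (H : Submodule ℝ (S × Fin 2 → ℝ)) (hH : ¬ coordPlane p ≤ H) :
    (Finset.univ.filter fun i => ∃ k, tri i k = p ∧ gradPart (coords x) (tri i) k ∈ H).card ≤
      6 := by
  have hdir : ∀ i, (∃ k, tri i k = p ∧ gradPart (coords x) (tri i) k ∈ H) →
      ∃ d : ℝ × ℝ, d ≠ 0 ∧ rotated p d ∈ H ∧ ∃ q k l, k ≠ l ∧ tri i k = p ∧ tri i l = q ∧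
        (∃ a : ℝ, a ≠ 0 ∧ x q - x p = a • d) ∧ ∀ w ∈ P, ¬ Sbtw ℝ (x p) w (x q) := by
    rintro i ⟨k, rfl, hk⟩
    obtain ⟨d, hd, h⟩ := ConsecTriple.exists_direction (x := x ∘ tri i) (htri i)
    obtain ⟨l, hl, hadj⟩ := ConsecTriple.exists_adjacent (x := x ∘ tri i) (htri i) k
    obtain ⟨a, ha, hka⟩ := h (k + 1) (k + 2) (by simp)
    refine ⟨d, hd, ?_, tri i l, k, l, hl.symm, rfl, rfl, h k l hl.symm, hadj⟩
    rw [gradPart_coords hka] at hk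
    exact (H.smul_mem_iff ha).1 hk
  obtain hempty | ⟨i₀, hi₀⟩ := (Finset.univ.filter fun i =>
      ∃ k, tri i k = p ∧ gradPart (coords x) (tri i) k ∈ H).eq_empty_or_nonempty
  · simp [hempty]
  obtain ⟨d, hd, hdH, -⟩ := hdir i₀ (by simpa using hi₀)
  let N : ℝ × ℝ → Finset S := fun d => Finset.univ.filter fun q =>
    (∃ a : ℝ, 0 < a ∧ x q - x p = a • d) ∧ ∀ w ∈ P, ¬ Sbtw ℝ (x p) w (x q)
  have hN : (N d ∪ N (-d)).card ≤ 2 := (Finset.card_union_le _ _).trans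
    (add_le_add (card_filter_adjacent_le_one hx hxP p hd)
      (card_filter_adjacent_le_one hx hxP p (neg_ne_zero.2 hd)))
  have hsub : (Finset.univ.filter fun i =>
      ∃ k, tri i k = p ∧ gradPart (coords x) (tri i) k ∈ H) ⊆
      (N d ∪ N (-d)).biUnion fun q =>
        Finset.univ.filter fun i => ∃ k l, k ≠ l ∧ tri i k = p ∧ tri i l = q := by
    intro i hi
    obtain ⟨e, he, heH, q, k, l, hkl, hk, hl, ⟨a, ha, hqa⟩, hadj⟩ := hdir i (by simpa using hi)
    have hcross : d.1 * e.2 - d.2 * e.1 = 0 := by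
      by_contra hne
      exact hH (coordPlane_le hdH heH hne)
    obtain ⟨b, hb, rfl⟩ := exists_smul_eq_of_cross_eq_zero he hd hcross
    rw [Finset.mem_biUnion]
    refine ⟨q, ?_, by simpa using ⟨k, l, hkl, hk, hl⟩⟩
    rw [smul_smul] at hqa
    simp only [N, Finset.mem_union, Finset.mem_filter, Finset.mem_univ, true_and]
    rcases (mul_ne_zero ha hb).lt_or_gt with h | h
    · exact Or.inr ⟨⟨-(a * b), neg_pos.2 h, by rw [hqa]; module⟩, hadj⟩
    · exact Or.inl ⟨⟨a * b, h, hqa⟩, hadj⟩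
  calc _ ≤ _ := Finset.card_le_card hsub
    _ ≤ (N d ∪ N (-d)).card * 3 :=
      Finset.card_biUnion_le_card_mul _ _ _ fun q _ => card_filter_pair_le htri hinj p q
    _ ≤ 6 := by omega

end ConsecutiveTriples

section Extraction

open Classical in
/-- A family with at least `2 * D * |P|` members on the ground set `P` has a subset of `P` inducing
at least `D * |P|` members and in which every point has degree at least `D`. -/
lemma exists_subset_forall_le_degree {α : Type*} (P : Finset α) (F : Finset (Set α))
    (hF : ∀ u ∈ F, u ⊆ P) {D : ℝ} (hD0 : 0 ≤ D) (hD : 2 * D * P.card ≤ F.card) :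
    ∃ Q ⊆ P, D * P.card ≤ (F.filter fun u => u ⊆ (Q : Set α)).card ∧
      ∀ p ∈ Q, D ≤ (F.filter fun u => u ⊆ (Q : Set α) ∧ p ∈ u).card := by
  let e : Finset α → Finset (Set α) := fun Q => F.filter fun u => u ⊆ Q
  obtain ⟨Q, hQ, hmax⟩ := Finset.exists_max_image P.powerset
    (fun Q => ((e Q).card : ℝ) - D * Q.card) ⟨P, by simp⟩
  rw [Finset.mem_powerset] at hQ
  refine ⟨Q, hQ, ?_, fun p hp => ?_⟩
  · have h1 := hmax P (by simp)
    have h2 : e P = F := Finset.filter_true_of_mem hF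
    simp only [h2] at h1
    have h3 : 0 ≤ D * Q.card := by positivity
    linarith
  · have h1 := hmax (Q.erase p) (by simpa using (Finset.erase_subset p Q).trans hQ)
    have h2 : e Q ⊆ e (Q.erase p) ∪ F.filter fun u => u ⊆ (Q : Set α) ∧ p ∈ u := by
      intro u hu
      simp only [e, Finset.mem_union, Finset.mem_filter] at hu ⊢
      by_cases hpu : p ∈ u
      · exact Or.inr ⟨hu.1, hu.2, hpu⟩
      · refine Or.inl ⟨hu.1, fun w hw => ?_⟩
        rw [Finset.coe_erase]
        exact ⟨hu.2 hw, fun h : w = p => hpu (h ▸ hw)⟩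
    have h3 : ((e Q).card : ℝ) ≤ (e (Q.erase p)).card +
        (F.filter fun u => u ⊆ (Q : Set α) ∧ p ∈ u).card := by
      exact_mod_cast (Finset.card_le_card h2).trans (Finset.card_union_le _ _)
    have h4 : (Q.card : ℝ) = (Q.erase p).card + 1 := by
      exact_mod_cast (Finset.card_erase_add_one hp).symm
    rw [h4] at h1
    linarith

lemma finite_consecTriples {P : Set (ℝ × ℝ)} (hP : P.Finite) : (ConsecTriples P).Finite := by
  refine hP.finite_subsets.subset ?_
  rintro _ ⟨x, y, z, rfl, hx, hy, hz, -⟩ w (rfl | rfl | rfl) <;> assumption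

lemma collinear_image_emb {s : Set (ℝ × ℝ)} (h : Collinear ℝ s) : Collinear ℂ (emb '' s) := by
  obtain ⟨p, v, hv⟩ := (collinear_iff_exists_forall_eq_smul_vadd (k := ℝ) s).1 h
  refine (collinear_iff_exists_forall_eq_smul_vadd (k := ℂ) _).2 ⟨emb p, emb v, ?_⟩
  rintro _ ⟨q, hq, rfl⟩
  obtain ⟨a, rfl⟩ := hv q hq
  exact ⟨a, by ext <;> simp [emb]⟩

end Extraction

section Main

open Module Submodule

variable {P : Set (ℝ × ℝ)} {S ι : Type*} [Fintype S] [Fintype ι] {x : S → ℝ × ℝ}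
  {tri : ι → Fin 3 → S}

open Classical in
lemma degree_le (htri : ∀ i, ConsecTriple P (x (tri i 0)) (x (tri i 1)) (x (tri i 2)))
    (hinj : Function.Injective fun i =>
      ({x (tri i 0), x (tri i 1), x (tri i 2)} : Set (ℝ × ℝ))) (p : S) :
    (Finset.univ.filter fun i => ∃ k, tri i k = p).card ≤ Fintype.card S * 3 := by
  refine (Finset.card_le_card (t := Finset.univ.biUnion fun q =>
    Finset.univ.filter fun i => ∃ k l, k ≠ l ∧ tri i k = p ∧ tri i l = q) ?_).trans
    (Finset.card_biUnion_le_card_mul _ _ _ fun q _ => card_filter_pair_le htri hinj p q)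
  intro i hi
  simp only [Finset.mem_filter, Finset.mem_univ, true_and, Finset.mem_biUnion] at hi ⊢
  obtain ⟨k, hk⟩ := hi
  exact ⟨tri i (k + 1), k, k + 1, by simp, hk, rfl⟩

/-- In a configuration of `m ≤ n` points and consecutive triples of minimum degree at least
`C / 2 * n`, the collinearity gradients have corank at most `576 / C`. -/
lemma two_mul_card_sub_finrank_gradients_le (hx : Function.Injective x) (hxP : ∀ s, x s ∈ P)
    (htri : ∀ i, ConsecTriple P (x (tri i 0)) (x (tri i 1)) (x (tri i 2)))
    (hinj : Function.Injective fun i =>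
      ({x (tri i 0), x (tri i 1), x (tri i 2)} : Set (ℝ × ℝ)))
    {C n : ℝ} (hC : 0 < C) (hn : 0 < n) (hcard : Fintype.card S ≤ n)
    (hdeg : ∀ p, ∃ G : Finset ι, C / 2 * n ≤ G.card ∧ ∀ i ∈ G, ∃ k, tri i k = p) :
    2 * Fintype.card S -
      finrank ℝ (span ℝ (Set.range fun i => ∑ k, gradPart (coords x) (tri i) k)) ≤ 576 / C := by
  classical
  rw [le_div_iff₀ hC]
  by_cases hsmall : C * n ≤ 24
  · nlinarith [Nat.cast_nonneg (α := ℝ) (finrank ℝ (span ℝ (Set.range fun i =>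
      ∑ k, gradPart (coords x) (tri i) k)))]
  have h := corank_le (A := coordPlane) finrank_coordPlane_le iSup_coordPlane tri
    (fun i k => gradPart (coords x) (tri i) k) (fun i k => gradPart_mem_coordPlane _ _)
    (fun p q => by convert card_filter_pair_le htri hinj p q) (D := C / 2 * n) (K := C * n / 288)
    (by positivity) (by linarith)
    (fun p => by
      obtain ⟨G, hG, hGp⟩ := hdeg p
      refine hG.trans (Nat.cast_le.2 (Finset.card_le_card fun i hi => ?_))
      simpa using hGp i hi)
    (fun p H hH => by convert card_filter_gradPart_mem_le hx hxP htri hinj p H hH)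
  rw [finrank_fintype_fun_eq_card, Fintype.card_prod, Fintype.card_fin] at h
  push_cast at h
  set d : ℝ := 2 * Fintype.card S -
      finrank ℝ (span ℝ (Set.range fun i => ∑ k, gradPart (coords x) (tri i) k)) with hd
  have h2 : n * (d * C) ≤ n * 576 := by
    rw [hd]
    linarith
  exact le_of_mul_le_mul_left h2 hn

end Main

/-- If a set `P` of `n` points in `ℝ²` determines at least `C n²` consecutive
collinear triples, then there are `P' ⊆ P` with `|P'| ≥ c n` and a collection
`T'` of at least `c n²` triples of points of `P'`, each a consecutive collinear
triple of `P`, such that `P'` is `r`-rigid with respect to `T'`; here `c > 0`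
and the positive integer `r` depend only on `C`. -/
theorem consec_triples_rigidity (C : ℝ) (hC : 0 < C) :
    ∃ (c : ℝ) (r : ℕ), 0 < c ∧ 0 < r ∧
      ∀ P : Set (ℝ × ℝ), P.Finite →
        C * (P.ncard : ℝ) ^ 2 ≤ ((ConsecTriples P).ncard : ℝ) →
        ∃ P' ⊆ P, ∃ T' : Set (Set ↥P'),
          c * (P.ncard : ℝ) ≤ (P'.ncard : ℝ) ∧
          c * (P.ncard : ℝ) ^ 2 ≤ (T'.ncard : ℝ) ∧
          (∀ u ∈ T', Subtype.val '' u ∈ ConsecTriples P) ∧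
          IsRigid T' (fun p : ↥P' => emb (p : ℝ × ℝ)) r := by
  classical
  refine ⟨C / 6, ⌈576 / C⌉₊ + 1, by positivity, by positivity, fun P hP hCP => ?_⟩
  have hfin := finite_consecTriples hP
  set n := P.ncard with hn
  obtain ⟨Q, hQ, hcard, hdeg⟩ := exists_subset_forall_le_degree hP.toFinset hfin.toFinset
    (fun u hu => by
      obtain ⟨x, y, z, rfl, hx, hy, hz, -⟩ := hfin.mem_toFinset.1 hu
      rintro w (rfl | rfl | rfl) <;> simpa)
    (D := C / 2 * n) (by positivity) (by
      rw [← Set.ncard_eq_toFinset_card _ hP, ← Set.ncard_eq_toFinset_card _ hfin]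
      linarith)
  rw [← Set.ncard_eq_toFinset_card _ hP, ← hn] at hcard
  have hQP : (Q : Set (ℝ × ℝ)) ⊆ P := by simpa using hQ
  set F := hfin.toFinset.filter fun u => u ⊆ (Q : Set (ℝ × ℝ)) with hF
  let T' : Set (Set (Q : Set (ℝ × ℝ))) := {u | Subtype.val '' u ∈ ConsecTriples P}
  have hT' : T'.ncard = F.card := by
    rw [← Set.ncard_image_of_injective T' (Set.image_injective.2 Subtype.val_injective),
      ← Set.ncard_coe_finset]
    congr 1
    ext u
    simp only [hF, Finset.coe_filter, Set.Finite.mem_toFinset, Set.mem_image, Set.mem_ofPred_eq, T']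
    constructor
    · rintro ⟨v, hv, rfl⟩
      exact ⟨hv, Subtype.coe_image_subset _ _⟩
    · rintro ⟨hu, huQ⟩
      have : Subtype.val '' ((Subtype.val : ↥(Q : Set (ℝ × ℝ)) → ℝ × ℝ) ⁻¹' u) = u := by
        rwa [Subtype.image_preimage_coe, Set.inter_eq_right]
      exact ⟨_, this.symm ▸ hu, this⟩
  have hsplit (u : F) : ∃ t : Fin 3 → (Q : Set (ℝ × ℝ)),
      u.1 = {(t 0 : ℝ × ℝ), (t 1 : ℝ × ℝ), (t 2 : ℝ × ℝ)} ∧ ConsecTriple P (t 0) (t 1) (t 2) := by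
    obtain ⟨u, hu⟩ := u
    simp only [hF, Finset.mem_filter, Set.Finite.mem_toFinset] at hu
    obtain ⟨⟨x, y, z, rfl, h⟩, huQ⟩ := hu
    exact ⟨![⟨x, huQ (by simp)⟩, ⟨y, huQ (by simp)⟩, ⟨z, huQ (by simp)⟩], rfl, h⟩
  choose tri htri hconsec using hsplit
  have hinj : Function.Injective fun u : F =>
      ({(tri u 0 : ℝ × ℝ), (tri u 1 : ℝ × ℝ), (tri u 2 : ℝ × ℝ)} : Set (ℝ × ℝ)) := by
    intro u v huv
    exact Subtype.ext ((htri u).trans (huv.trans (htri v).symm))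
  have hdeg' (p : (Q : Set (ℝ × ℝ))) :
      ∃ G : Finset F, C / 2 * n ≤ G.card ∧ ∀ i ∈ G, ∃ k, tri i k = p := by
    refine ⟨Finset.univ.filter fun u => p.1 ∈ u.1, (hdeg p p.2).trans ?_, fun u hu => ?_⟩
    · rw [Nat.cast_le, ← Finset.card_map (Function.Embedding.subtype _)]
      refine Finset.card_le_card fun u hu => ?_
      simp only [Finset.mem_filter] at hu
      simpa [hF, hu] using hfin.mem_toFinset.1 hu.1
    · have hpu : p.1 ∈ u.1 := by simpa using hu
      rw [htri u] at hpu
      rcases hpu with h | h | h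
      · exact ⟨0, Subtype.ext h.symm⟩
      · exact ⟨1, Subtype.ext h.symm⟩
      · exact ⟨2, Subtype.ext h.symm⟩
  refine ⟨Q, hQP, T', ?_, ?_, fun u hu => hu, ?_⟩
  · rw [Set.ncard_coe_finset]
    rcases n.eq_zero_or_pos with hn0 | hnpos
    · simp [hn0]
    · have hFpos : 0 < (F.card : ℝ) := lt_of_lt_of_le (by positivity) hcard
      obtain ⟨u, hu⟩ := Finset.card_pos.1 (Nat.cast_pos.1 hFpos)
      obtain ⟨G, hG, hGp⟩ := hdeg' (tri ⟨u, hu⟩ 0)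
      have h := degree_le hconsec hinj (tri ⟨u, hu⟩ 0)
      have h2 : G.card ≤ Q.card * 3 := by
        refine (Finset.card_le_card fun i hi => ?_).trans (h.trans (by simp))
        simpa using hGp i hi
      have h3 : (G.card : ℝ) ≤ Q.card * 3 := by exact_mod_cast h2
      linarith
  · rw [hT']
    have : 0 ≤ C * (n : ℝ) ^ 2 := by positivity
    linarith
  · refine isRigid_of_finrank_gradients tri (fun u => ?_) _ (fun u hu => ?_) ?_
    · have hu : u.1 ∈ ConsecTriples P := ⟨_, _, _, htri u, hconsec u⟩
      simpa only [T', Set.mem_ofPred_eq, Set.image_insert_eq, Set.image_singleton, ← htri u]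
    · rw [← Function.comp_def, Set.image_comp]
      obtain ⟨x, y, z, hxyz, h⟩ := hu
      rw [hxyz]
      exact collinear_image_emb h.2.2.2.1.wbtw.collinear
    · have hQn : Q.card ≤ n := by
        rw [← Set.ncard_coe_finset]
        exact Set.ncard_le_ncard hQP hP
      rcases n.eq_zero_or_pos with hn0 | hnpos
      · simp [Finset.card_eq_zero.1 (Nat.le_zero.1 (hn0 ▸ hQn))]
      · have h := two_mul_card_sub_finrank_gradients_le Subtype.val_injective
          (fun s => hQP s.2) hconsec hinj hC (n := n) (by exact_mod_cast hnpos)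
          (by simpa using hQn) hdeg'
        have h2 := h.trans (Nat.le_ceil _)
        rw [sub_le_iff_le_add] at h2
        have h3 : 2 * Fintype.card (Q : Set (ℝ × ℝ)) ≤ ⌈576 / C⌉₊ +
            Module.finrank ℝ (Submodule.span ℝ (Set.range fun i =>
              ∑ k, gradPart (coords Subtype.val) (tri i) k)) := by
          exact_mod_cast h2
        exact h3.trans (Nat.add_le_add_right (Nat.le_succ _) _)
end
end
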